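/- arXiv:2510.10848 — 3 statements merged into one kernel-verified Lean document; each statement's English description precedes it below -/
import Mathlib

section
/- Let (Ω, f) be a topologically transitive finitely presented (FP) system with Ω nonempty. Then LPS(f) is either a singleton, or of the form F ∪ ⋃_{i=1}^n d_i S_i with F ⊆ ℕ finite, n ≥ 1, d_1, ..., d_n positive integers and S_1, ..., S_n ⊆ ℕ cofinite (in particular with at least one cofinite set d_iS_i appearing). -/
/-- The shift map on the full shift `A^ℤ`: `(σ x) i = x (i+1)`. -/
def shiftMap {A : Type*} : (ℤ → A) → (ℤ → A) := fun x i => x (i + 1)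

/-- A one-step shift of finite type: the set of bi-infinite sequences all of whose
adjacent pairs lie in a relation `R ⊆ A × A`. -/
def IsOneStepSFT {A : Type*} (X : Set (ℤ → A)) : Prop :=
  ∃ R : Set (A × A), X = {x | ∀ i : ℤ, (x i, x (i + 1)) ∈ R}

/-- An expansive homeomorphism: some `ε > 0` separates every pair of distinct points
under some (possibly negative) iterate. -/
def ExpansiveHomeo {Ω : Type*} [MetricSpace Ω] (f : Ω ≃ₜ Ω) : Prop :=
  ∃ ε : ℝ, 0 < ε ∧ ∀ x y : Ω, x ≠ y →
    ∃ n : ℤ, ε < dist ((f.toEquiv ^ n) x) ((f.toEquiv ^ n) y)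

/-- A finitely presented (FP) system: an expansive homeomorphism of a compact metric
space which is a factor of some one-step SFT over some finite alphabet. -/
def IsFPSystem {Ω : Type*} [MetricSpace Ω] [CompactSpace Ω] (f : Ω ≃ₜ Ω) : Prop :=
  ExpansiveHomeo f ∧
    ∃ (m : ℕ) (X : Set (ℤ → Fin m)) (π : (ℤ → Fin m) → Ω),
      IsOneStepSFT X ∧ ContinuousOn π X ∧ π '' X = Set.univ ∧
        ∀ x ∈ X, π (shiftMap x) = f (π x)

/-- The least period set of a map `f`: those `n ≥ 1` for which there exists a point of
least period exactly `n`. -/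
def leastPeriodSet {Ω : Type*} (f : Ω → Ω) : Set ℕ :=
  {n | 0 < n ∧ ∃ x, f^[n] x = x ∧ ∀ k, 0 < k → k < n → f^[k] x ≠ x}

/-- `S` is a cofinite subset of `ℕ = {1, 2, 3, ...}`. -/
def CofinitePos (S : Set ℕ) : Prop :=
  S ⊆ {n : ℕ | 0 < n} ∧ ({n : ℕ | 0 < n} \ S).Finite

/-- Topological transitivity of a map `f` on a topological space. -/
def TopTrans {Ω : Type*} [TopologicalSpace Ω] (f : Ω → Ω) : Prop :=
  ∀ U V : Set Ω, IsOpen U → IsOpen V → U.Nonempty → V.Nonempty →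
    ∃ n : ℕ, 0 < n ∧ (U ∩ f^[n] ⁻¹' V).Nonempty

/-- The bi-infinite walks along a relation `R`. -/
def walks {V : Type*} (R : V → V → Prop) : Set (ℤ → V) :=
  {x | ∀ i, R (x i) (x (i + 1))}

/-- A factor map `π` from the walks along `R` onto the system `(Ω, e)`. -/
structure IsWalkFactor {Ω V : Type*} (e : Equiv.Perm Ω) (R : V → V → Prop)
    (π : (ℤ → V) → Ω) : Prop where
  surj : ∀ ω, ∃ x ∈ walks R, π x = ω
  equivariant : ∀ x ∈ walks R, ∀ n : ℤ, π (fun i => x (i + n)) = (e ^ n) (π x)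

/-- A factor map from the walks along `R` whose fibres are described coordinatewise by a
relation `S` on the symbols. -/
structure IsFinitePresentation {Ω V : Type*} (e : Equiv.Perm Ω) (R S : V → V → Prop)
    (π : (ℤ → V) → Ω) : Prop extends IsWalkFactor e R π where
  eq_iff : ∀ x ∈ walks R, ∀ y ∈ walks R, π x = π y ↔ ∀ i, S (x i) (y i)

section Walks

variable {V : Type*} {R : V → V → Prop}

theorem walks_shift {x : ℤ → V} (hx : x ∈ walks R) (n : ℤ) :
    (fun i => x (i + n)) ∈ walks R := by
  intro i
  have := hx (i + n)
  rwa [show i + n + 1 = i + 1 + n by ring] at this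

theorem emod_add_one_cases (i n : ℤ) (hn : 0 < n) :
    ((i + 1) % n = i % n + 1 ∧ (i + 1) / n = i / n) ∨
      (i % n + 1 = n ∧ (i + 1) % n = 0 ∧ (i + 1) / n = i / n + 1) := by
  have h0 := Int.emod_nonneg i hn.ne'
  have h1 := Int.emod_lt_of_pos i hn
  have h2 := Int.mul_ediv_add_emod i n
  rcases eq_or_ne (i % n + 1) n with h | h
  · right
    have h3 : i + 1 = n * (i / n + 1) := by linarith
    refine ⟨h, ?_, ?_⟩
    · rw [h3, Int.mul_emod_right]
    · conv_lhs => rw [h3]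
      exact Int.mul_ediv_cancel_left _ hn.ne'
  · left
    have h3 : i + 1 = (i % n + 1) + n * (i / n) := by linarith
    have h4 : i % n + 1 < n := by omega
    constructor
    · conv_lhs => rw [h3]
      rw [Int.add_mul_emod_self_left, Int.emod_eq_of_lt (by omega) h4]
    · conv_lhs => rw [h3]
      rw [Int.add_mul_ediv_left _ _ hn.ne', Int.ediv_eq_zero_of_lt (by omega) h4, zero_add]

theorem periodize_mem_walks {x : ℤ → V} (hx : x ∈ walks R) {a n : ℤ} (hn : 0 < n)
    (h : x a = x (a + n)) : (fun i => x (a + i % n)) ∈ walks R := by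
  intro i
  have hs := hx (a + i % n)
  rcases emod_add_one_cases i n hn with ⟨h1, -⟩ | ⟨h1, h2, -⟩
  · simpa only [h1, add_assoc] using hs
  · simp only [h2, add_zero]
    rw [add_assoc, h1, ← h] at hs
    exact hs

theorem eq_of_periodic_mul {α : Type*} {x : ℤ → α} {n : ℤ} (h : ∀ i, x (i + n) = x i) (q i : ℤ) :
    x (i + q * n) = x i := by
  have := (show Function.Periodic x n from h).int_mul q i
  simpa using this

theorem eq_emod_of_periodic {α : Type*} {x : ℤ → α} {n : ℤ} (h : ∀ i, x (i + n) = x i) (i : ℤ) :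
    x i = x (i % n) := by
  have := eq_of_periodic_mul h (i / n) (i % n)
  rwa [mul_comm, Int.emod_add_mul_ediv] at this

end Walks

section Presentation

variable {Ω V : Type*} {e : Equiv.Perm Ω} {R S : V → V → Prop} {π : (ℤ → V) → Ω}

theorem perm_zpow_eq_of_isPeriodicPt {ω : Ω} {n : ℕ} (h : Function.IsPeriodicPt e n ω) (q : ℤ) :
    (e ^ (q * n)) ω = ω := by
  have h1 : (e ^ n) ω = ω := by
    rw [← Equiv.Perm.iterate_eq_pow]; exact h
  rw [mul_comm, zpow_mul, zpow_natCast]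
  exact Equiv.Perm.zpow_apply_eq_self_of_apply_eq_self h1 q

theorem isPeriodicPt_iff_zpow {ω : Ω} {n : ℕ} :
    Function.IsPeriodicPt e n ω ↔ (e ^ (n : ℤ)) ω = ω := by
  rw [zpow_natCast, ← Equiv.Perm.iterate_eq_pow]; rfl

theorem IsWalkFactor.isPeriodicPt_of_periodic (hP : IsWalkFactor e R π) {x : ℤ → V}
    (hx : x ∈ walks R) {n : ℕ} (h : ∀ i, x (i + n) = x i) :
    Function.IsPeriodicPt e n (π x) := by
  rw [isPeriodicPt_iff_zpow, ← hP.equivariant x hx]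
  congr 1
  exact funext h

theorem IsFinitePresentation.rel_of_isPeriodicPt (hP : IsFinitePresentation e R S π) {x : ℤ → V}
    (hx : x ∈ walks R) {n : ℕ} (h : Function.IsPeriodicPt e n (π x)) (q i : ℤ) :
    S (x i) (x (i + q * n)) := by
  refine (hP.eq_iff x hx _ (walks_shift hx (q * n))).1 ?_ i
  rw [hP.equivariant x hx, perm_zpow_eq_of_isPeriodicPt h]

/-- Every periodic point of a finitely presented system has a periodic lift, whose period is a
bounded multiple of the given one. -/
theorem IsFinitePresentation.exists_periodic_lift [Fintype V]
    (hP : IsFinitePresentation e R S π) {n : ℕ} (hn : 0 < n) {ω : Ω}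
    (h : Function.IsPeriodicPt e n ω) :
    ∃ z ∈ walks R, π z = ω ∧
      ∀ i, z (i + ((Fintype.card V).factorial * n : ℕ)) = z i := by
  obtain ⟨x, hx, rfl⟩ := hP.surj ω
  obtain ⟨j, k, hk, hkc, hjk⟩ : ∃ j k : ℕ, 0 < k ∧ k ≤ Fintype.card V ∧
      x ((j * n : ℕ) : ℤ) = x (((j + k) * n : ℕ) : ℤ) := by
    obtain ⟨p, q, hpq, hxpq⟩ := Fintype.exists_ne_map_eq_of_card_lt
      (fun j : Fin (Fintype.card V + 1) => x ((j.val * n : ℕ) : ℤ)) (by simp)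
    rcases lt_or_gt_of_ne hpq with hlt | hlt
    · refine ⟨p, q - p, by omega, by omega, ?_⟩
      rw [Nat.add_sub_cancel' (by omega)]
      exact hxpq
    · refine ⟨q, p - q, by omega, by omega, ?_⟩
      rw [Nat.add_sub_cancel' (by omega)]
      exact hxpq.symm
  have hkn : (0 : ℤ) < k * n := by positivity
  have hz := periodize_mem_walks hx (a := j * n) hkn (by
    push_cast at hjk; rw [hjk]; congr 1; ring)
  refine ⟨_, hz, ?_, ?_⟩
  · have h1 : π x = π (fun i => x (i + j * n)) := by
      rw [hP.equivariant x hx, perm_zpow_eq_of_isPeriodicPt h]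
    rw [h1]
    refine (hP.eq_iff _ hz _ (walks_shift hx _)).2 fun i => ?_
    have h2 := hP.rel_of_isPeriodicPt hx h (i / (k * n) * k) (j * n + i % (k * n))
    have h3 := Int.mul_ediv_add_emod i (k * n)
    convert h2 using 2
    linear_combination -h3
  · intro i
    obtain ⟨c, hc⟩ := Nat.dvd_factorial hk hkc
    congr 2
    rw [hc]
    push_cast
    rw [show (k * c * n : ℤ) = k * n * c by ring, Int.add_mul_emod_self_left]

theorem IsFinitePresentation.finite_isPeriodicPt [Fintype V]
    (hP : IsFinitePresentation e R S π) {n : ℕ} (hn : 0 < n) :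
    {ω | Function.IsPeriodicPt e n ω}.Finite := by
  set N := (Fintype.card V).factorial * n with hN
  have hN0 : 0 < N := by positivity
  have hfin : {z : ℤ → V | ∀ i, z (i + N) = z i}.Finite := by
    refine Set.Finite.of_finite_image (f := fun z => fun t : Fin N => z (t.val : ℤ))
      (Set.toFinite _) ?_
    intro z hz y hy hzy
    funext i
    rw [eq_emod_of_periodic hz, eq_emod_of_periodic hy]
    have h0 := Int.emod_nonneg i (b := (N : ℤ)) (by omega)
    have h1 := Int.emod_lt_of_pos i (b := (N : ℤ)) (by omega)
    have h2 := congrFun hzy ⟨(i % N).toNat, by omega⟩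
    simpa only [Int.toNat_of_nonneg h0] using h2
  refine (hfin.image π).subset fun ω hω => ?_
  obtain ⟨z, -, hzω, hzN⟩ := hP.exists_periodic_lift hn hω
  exact ⟨z, hzN, hzω⟩

end Presentation

/-- A bi-infinite path of `K`-tuples of pairwise `S`-related symbols, each coordinate walking
along `R`, which starts at `s` and comes back after `n` steps up to the rotation by `c` of the
coordinates. -/
structure TwistedLoop {V : Type*} {K : ℕ} (R S : V → V → Prop) (s : ZMod K → V) (n : ℕ)
    (c : ZMod K) (W : ℤ → ZMod K → V) : Prop where
  start : W 0 = s
  compat : ∀ i j k, S (W i j) (W i k)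
  step : ∀ i j, R (W i j) (W (i + 1) j)
  twist : ∀ i j, W (i + n) j = W i (j + c)

namespace TwistedLoop

variable {V : Type*} {K : ℕ} {R S : V → V → Prop} {s : ZMod K → V} {n : ℕ} {c : ZMod K}
  {W : ℤ → ZMod K → V}

theorem mul (h : TwistedLoop R S s n c W) (r : ℕ) : TwistedLoop R S s (r * n) (r * c) W := by
  refine ⟨h.start, h.compat, h.step, ?_⟩
  induction r with
  | zero => simp
  | succ r ih =>
    intro i j
    have h1 := h.twist (i + (r * n : ℕ)) j
    rw [ih] at h1
    push_cast at h1 ⊢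
    rw [show i + (r + 1) * (n : ℤ) = i + r * n + n by ring, h1]
    congr 1
    ring

theorem mul_card (h : TwistedLoop R S s n c W) (r : ℕ) :
    TwistedLoop R S s (r * K * n) 0 W := by
  simpa using h.mul (r * K)

theorem mem_walks (h : TwistedLoop R S s n c W) (j : ZMod K) : (fun i => W i j) ∈ walks R :=
  fun i => h.step i j

theorem concat {n' : ℕ} {c' : ZMod K} {W' : ℤ → ZMod K → V} (h : TwistedLoop R S s n c W)
    (h' : TwistedLoop R S s n' c' W') (hn' : 0 < n') :
    ∃ W'', TwistedLoop R S s (n + n') (c + c') W'' ∧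
      (∀ i : ℤ, 0 ≤ i → i ≤ n → W'' i = W i) ∧
      (∀ (i : ℤ) (j : ZMod K), 0 ≤ i → i < n' → W'' (n + i) j = W' i (j + c)) := by
  have hN : (0 : ℤ) < n + n' := by omega
  set P : ℤ → ZMod K → V := fun t j => if t < n then W t j else W' (t - n) (j + c) with hP
  have hPcompat : ∀ t j k, S (P t j) (P t k) := by
    intro t j k
    simp only [hP]
    split_ifs
    · exact h.compat _ _ _
    · exact h'.compat _ _ _
  have hPn : ∀ j, W n j = W' 0 (j + c) := by
    intro j
    rw [h'.start, ← h.start]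
    simpa using h.twist 0 j
  have hPstep : ∀ t j, R (P t j) (P (t + 1) j) := by
    intro t j
    simp only [hP]
    rcases lt_trichotomy (t + 1) n with ht | ht | ht
    · rw [if_pos (by omega), if_pos ht]
      exact h.step _ _
    · rw [if_pos (by omega), if_neg (by omega), ht, sub_self, ← hPn, ← ht]
      exact h.step _ _
    · rw [if_neg (by omega), if_neg (by omega), show t + 1 - n = t - n + 1 by ring]
      exact h'.step _ _
  have hP0 : P 0 = s := by
    funext j
    simp only [hP]
    rcases Nat.eq_zero_or_pos n with hn | hn
    · rw [if_neg (by omega), ← h.start, hn, Nat.cast_zero, sub_zero, ← hPn, hn]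
      rfl
    · rw [if_pos (by omega), h.start]
  have hPend : ∀ j, P (n + n') j = P 0 (j + (c + c')) := by
    intro j
    have h2 := h'.twist 0 (j + c)
    rw [hP0, ← h'.start, ← add_assoc, ← h2]
    simp only [hP]
    rw [if_neg (by omega)]
    congr 1
    ring
  refine ⟨fun i j => P (i % (n + n')) (j + (i / (n + n') : ℤ) * (c + c')),
    ⟨?_, fun i j k => hPcompat _ _ _, ?_, ?_⟩, ?_, ?_⟩
  · funext j
    simp [hP0]
  · intro i j
    have hs := hPstep (i % (n + n')) (j + (i / (n + n') : ℤ) * (c + c'))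
    rcases emod_add_one_cases i _ hN with ⟨h1, h2⟩ | ⟨h1, h2, h3⟩
    · simpa only [h1, h2] using hs
    · rw [h1, hPend] at hs
      simp only [h2, h3]
      convert hs using 2
      push_cast
      ring
  · intro i j
    push_cast
    rw [Int.add_emod_right, Int.add_ediv_of_dvd_right dvd_rfl, Int.ediv_self hN.ne']
    congr 1
    push_cast
    ring
  · intro i hi hin
    funext j
    simp only
    rw [Int.emod_eq_of_lt hi (by omega), Int.ediv_eq_zero_of_lt hi (by omega)]
    simp only [Int.cast_zero, zero_mul, add_zero, hP]
    rcases hin.lt_or_eq with hlt | rfl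
    · rw [if_pos hlt]
    · rw [if_neg (lt_irrefl _), sub_self, hPn]
  · intro i j hi hin
    simp only
    rw [Int.emod_eq_of_lt (by omega) (by omega), Int.ediv_eq_zero_of_lt (by omega) (by omega)]
    simp only [Int.cast_zero, zero_mul, add_zero, hP]
    rw [if_neg (by omega), add_sub_cancel_left]

end TwistedLoop

section LoopPeriods

variable {Ω V : Type*} {K : ℕ} {e : Equiv.Perm Ω} {R S : V → V → Prop} {π : (ℤ → V) → Ω}

theorem TwistedLoop.isPeriodicPt {s : ZMod K → V} {n : ℕ} {c : ZMod K} {W : ℤ → ZMod K → V}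
    (h : TwistedLoop R S s n c W) (hP : IsFinitePresentation e R S π) :
    Function.IsPeriodicPt e n (π fun i => W i 0) := by
  rw [isPeriodicPt_iff_zpow, ← hP.equivariant _ (h.mem_walks 0)]
  refine (hP.eq_iff _ (walks_shift (h.mem_walks 0) n) _ (h.mem_walks 0)).2 fun i => ?_
  rw [h.twist]
  exact h.compat _ _ _

/-- The least periods of the points presented by the twisted loops at `s`. -/
def loopPeriods (e : Equiv.Perm Ω) (R S : V → V → Prop) (π : (ℤ → V) → Ω)
    (s : ZMod K → V) : Set ℕ :=
  {n | 0 < n ∧ ∃ c W, TwistedLoop R S s n c W ∧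
    Function.minimalPeriod e (π fun i => W i 0) = n}

theorem IsFinitePresentation.exists_mem_loopPeriods [Fintype V]
    (hP : IsFinitePresentation e R S π) (ω : Ω) (hω : 0 < Function.minimalPeriod e ω) :
    ∃ s : ZMod (Fintype.card V).factorial → V,
      Function.minimalPeriod e ω ∈ loopPeriods e R S π s := by
  set n := Function.minimalPeriod e ω with hn
  have hper : Function.IsPeriodicPt e n ω := Function.isPeriodicPt_minimalPeriod e ω
  obtain ⟨z, hz, rfl, hzK⟩ := hP.exists_periodic_lift hω hper
  set K := (Fintype.card V).factorial
  have hper2 : ∀ (i a b : ℤ), (a : ZMod K) = b → z (i + a * n) = z (i + b * n) := by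
    intro i a b hab
    obtain ⟨q, hq⟩ := (ZMod.intCast_eq_intCast_iff_dvd_sub _ _ _).1 hab
    have := eq_of_periodic_mul hzK q (i + a * n)
    rw [← this]
    congr 1
    push_cast
    linear_combination (-n : ℤ) * hq
  refine ⟨fun j => z (0 + (j.cast : ℤ) * n), hω, 1, fun i j => z (i + (j.cast : ℤ) * n),
    ⟨rfl, ?_, ?_, ?_⟩, ?_⟩
  · intro i j k
    have := hP.rel_of_isPeriodicPt hz hper (k.cast - j.cast : ℤ) (i + (j.cast : ℤ) * n)
    convert this using 2
    ring
  · intro i j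
    simpa only [add_right_comm] using hz (i + (j.cast : ℤ) * n)
  · intro i j
    rw [show i + (n : ℤ) + (j.cast : ℤ) * n = i + (j.cast + 1 : ℤ) * n by ring]
    exact hper2 _ _ _ (by simp)
  · simp [hn]

/-- A periodic point whose orbit first follows a walk of period `a` for a long time and then a
walk of larger least period has large least period. -/
theorem IsFinitePresentation.eq_of_dvd_of_follows (hP : IsFinitePresentation e R S π)
    {u v w : ℤ → V} (hu : u ∈ walks R) (hv : v ∈ walks R) (hw : w ∈ walks R) {a B p l m : ℕ}
    (ha : 0 < a) (hau : Function.IsPeriodicPt e a (π u))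
    (hav : a < Function.minimalPeriod e (π v)) (hB : 0 < B)
    (huB : ∀ i, u (i + B) = u i) (hvB : ∀ i, v (i + B) = v i)
    (hwu : ∀ i : ℤ, 0 ≤ i → i ≤ l → w i = u i)
    (hwv : ∀ i : ℤ, 0 ≤ i → i < B → w (l + i) = v i)
    (hp : 0 < p) (hwp : Function.IsPeriodicPt e p (π w)) (hpm : p ∣ m) (hm : 0 < m)
    (hlm : 2 * (l : ℤ) ≥ 2 * B + m) : p = m := by
  by_contra hne
  have h2p : 2 * p ≤ m := by
    obtain ⟨q, rfl⟩ := hpm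
    have hq : 2 ≤ q := by
      by_contra! hq
      interval_cases q <;> simp_all
    nlinarith
  set q : ℕ := B / p + 1
  have hq1 : B < q * p := by
    have := Nat.lt_div_mul_add (a := B) hp
    grind
  have hq2 : q * p ≤ B + p := by
    have := Nat.div_mul_le_self B p
    grind
  set d : ℤ := l - (q * p : ℕ) with hd
  have key : ∀ i : ℤ, 0 ≤ i → i < B → S (u (i + d)) (v i) := by
    intro i h0 h1
    have h2 := hP.rel_of_isPeriodicPt hw hwp q (i + d)
    rw [show i + d + (q : ℤ) * p = l + i by push_cast [hd]; ring, hwv i h0 h1,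
      hwu _ (by omega) (by omega)] at h2
    exact h2
  have heq : π (fun i => u (i + d)) = π v := by
    refine (hP.eq_iff _ (walks_shift hu d) _ hv).2 fun i => ?_
    have h1 := key (i % B) (Int.emod_nonneg _ (by omega)) (Int.emod_lt_of_pos _ (by omega))
    rw [← eq_emod_of_periodic hvB] at h1
    convert h1 using 1
    have := eq_of_periodic_mul huB (i / B) (i % B + d)
    rw [← this]
    congr 1
    have := Int.mul_ediv_add_emod i B
    linear_combination -this
  have hper : Function.IsPeriodicPt e a (π v) := by
    rw [← heq, hP.equivariant u hu, isPeriodicPt_iff_zpow, ← Equiv.Perm.mul_apply, ← zpow_add,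
      add_comm, zpow_add, Equiv.Perm.mul_apply, isPeriodicPt_iff_zpow.1 hau]
  exact absurd (hper.minimalPeriod_le ha) (not_le.2 hav)

theorem TwistedLoop.setGcd_eventually (s : ZMod K → V) :
    ∃ G, ∀ m ≥ G, Nat.setGcd {n | 0 < n ∧ ∃ c W, TwistedLoop R S s n c W} ∣ m →
      0 < m → ∃ c W, TwistedLoop R S s m c W := by
  obtain ⟨G, hG⟩ := Nat.exists_mem_closure_of_ge {n | 0 < n ∧ ∃ c W, TwistedLoop R S s n c W}
  refine ⟨G, fun m hm hd hm0 => ?_⟩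
  suffices h : m = 0 ∨ (0 < m ∧ ∃ c W, TwistedLoop R S s m c W) from
    (h.resolve_left hm0.ne').2
  refine AddSubmonoid.closure_induction
    (motive := fun m _ => m = 0 ∨ (0 < m ∧ ∃ c W, TwistedLoop R S s m c W))
    (fun n hn => Or.inr hn) (Or.inl rfl) ?_ (hG m hm hd)
  · rintro x y - - (rfl | ⟨hx, c, W, h⟩) (rfl | ⟨hy, c', W', h'⟩)
    · exact Or.inl rfl
    · simpa using Or.inr ⟨hy, c', W', h'⟩
    · simpa using Or.inr ⟨hx, c, W, h⟩
    · obtain ⟨W'', h'', -⟩ := h.concat h' hy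
      exact Or.inr ⟨by omega, _, W'', h''⟩

/-- If the set of least periods coming from loops at `s` is infinite, then it consists of
multiples of some `d > 0` all of whose large multiples are least periods. -/
theorem IsFinitePresentation.exists_dvd_of_infinite_loopPeriods [NeZero K]
    (hP : IsFinitePresentation e R S π) (s : ZMod K → V)
    (hs : (loopPeriods e R S π s).Infinite) :
    ∃ d > 0, (∀ n ∈ loopPeriods e R S π s, d ∣ n) ∧
      ∃ N, ∀ m ≥ N, d ∣ m → ∃ ω, Function.minimalPeriod e ω = m := by
  have hK : 0 < K := Nat.pos_of_neZero K
  obtain ⟨a, ha, cU, U, hU, haU⟩ := hs.nonempty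
  obtain ⟨b, ⟨hb, cV, V', hV, hbV⟩, hab⟩ := hs.exists_gt a
  obtain ⟨G, hG⟩ := TwistedLoop.setGcd_eventually (R := R) (S := S) s
  set d := Nat.setGcd {n | 0 < n ∧ ∃ c W, TwistedLoop R S s n c W} with hd
  have hdvd : ∀ n ∈ loopPeriods e R S π s, d ∣ n := fun n ⟨hn, c, W, h, _⟩ =>
    Nat.setGcd_dvd_of_mem ⟨hn, c, W, h⟩
  have hda : d ∣ a := hdvd a ⟨ha, cU, U, hU, haU⟩
  refine ⟨d, Nat.pos_of_dvd_of_pos hda ha, hdvd, ?_⟩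
  set a' := K * a with ha'
  set B := a' * (K * b) with hB
  have ha'0 : 0 < a' := by positivity
  have hB0 : 0 < B := by positivity
  refine ⟨2 * (2 * B + G + 1 + a'), fun m hm hdm => ?_⟩
  set r := (m - B - (G + 1)) / a' with hr
  set g := G + 1 + (m - B - (G + 1)) % a' with hg
  have hrg : m = r * a' + B + g := by
    have := Nat.div_add_mod' (m - B - (G + 1)) a'
    rw [← hr] at this
    omega
  have hga : g < G + 1 + a' := by
    have := Nat.mod_lt (m - B - (G + 1)) ha'0
    omega
  have hda' : d ∣ a' := hda.mul_left K
  have hdg : d ∣ g := by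
    rw [hrg] at hdm
    exact (Nat.dvd_add_right ((hda'.mul_left r).add (hda'.mul_right _))).1 hdm
  obtain ⟨cΓ, Γ, hΓ⟩ := hG g (by omega) hdg (by omega)
  have hUr : TwistedLoop R S s (r * a') 0 U := by
    simpa only [ha', mul_assoc] using hU.mul_card r
  have hUB : TwistedLoop R S s B 0 U := by
    convert hU.mul_card (K * b) using 1
    rw [hB, ha']; ring
  have hVB : TwistedLoop R S s B 0 V' := by
    convert hV.mul_card a' using 1
    rw [hB]; ring
  obtain ⟨W₁, hW₁, hWU, hWV⟩ := hUr.concat hVB hB0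
  obtain ⟨W, hW, hWW, -⟩ := hW₁.concat hΓ (by omega)
  rw [← hrg] at hW
  refine ⟨π fun i => W i 0, ?_⟩
  have hWper := hW.isPeriodicPt hP
  refine hP.eq_of_dvd_of_follows (l := r * a') (B := B) (hU.mem_walks 0) (hV.mem_walks 0)
    (hW.mem_walks 0) ha (hU.isPeriodicPt hP) (by omega) hB0 ?_ ?_ ?_ ?_
    (hWper.minimalPeriod_pos (by omega)) (Function.isPeriodicPt_minimalPeriod _ _)
    hWper.minimalPeriod_dvd (by omega) (by omega)
  · intro i
    simpa using hUB.twist i 0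
  · intro i
    simpa using hVB.twist i 0
  · intro i h0 h1
    rw [hWW i h0 (by push_cast at h1 ⊢; omega), hWU i h0 h1]
  · intro i h0 h1
    rw [hWW _ (by omega) (by push_cast at h1 ⊢; omega), hWV i 0 h0 h1, add_zero]

end LoopPeriods

/-- A finite union of sets of positive integers is, up to a finite set, a union of sets
`d * S` with `S` cofinite, as soon as each infinite one consists of multiples of some `d > 0`
all of whose large multiples occur. -/
theorem exists_finset_union_mul_cofinite {ι : Type*} [Finite ι] {L : Set ℕ} {M : ι → Set ℕ}
    (hpos : ∀ n ∈ L, 0 < n) (hinf : L.Infinite) (hL : L = ⋃ i, M i)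
    (hM : ∀ i, (M i).Infinite → ∃ d > 0, (∀ n ∈ M i, d ∣ n) ∧
      ∃ N, ∀ m ≥ N, d ∣ m → 0 < m → m ∈ L) :
    ∃ (F : Finset ℕ) (n : ℕ) (d : Fin n → ℕ) (S : Fin n → Set ℕ),
      0 < n ∧ (∀ m ∈ F, 0 < m) ∧ (∀ i, 0 < d i) ∧ (∀ i, CofinitePos (S i)) ∧
      L = ↑F ∪ ⋃ i : Fin n, (fun s => d i * s) '' S i := by
  classical
  have hfin : (⋃ i : {i // (M i).Finite}, M i).Finite := Set.finite_iUnion fun i => i.2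
  obtain ⟨n, ⟨φ⟩⟩ := Finite.exists_equiv_fin {i // (M i).Infinite}
  choose d hd hdvd N hN using fun i : {i // (M i).Infinite} => hM i i.2
  refine ⟨hfin.toFinset, n, fun k => d (φ.symm k),
    fun k => {t | 0 < t ∧ d (φ.symm k) * t ∈ L}, ?_, ?_, fun k => hd _, fun k => ?_, ?_⟩
  · by_contra! hn
    obtain rfl : n = 0 := by omega
    refine hinf (hfin.subset ?_)
    rw [hL]
    intro x hx
    obtain ⟨i, hi⟩ := Set.mem_iUnion.1 hx
    refine Set.mem_iUnion.2 ⟨⟨i, ?_⟩, hi⟩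
    by_contra hc
    exact (φ ⟨i, hc⟩).elim0
  · intro m hm
    rw [Set.Finite.mem_toFinset] at hm
    obtain ⟨i, hi⟩ := Set.mem_iUnion.1 hm
    exact hpos m (hL ▸ Set.mem_iUnion.2 ⟨i, hi⟩)
  · refine ⟨fun t ht => ht.1, (Set.finite_lt_nat (N (φ.symm k))).subset ?_⟩
    rintro t ⟨ht, ht'⟩
    by_contra! hc
    have hle : N (φ.symm k) ≤ t := by simpa using hc
    exact ht' ⟨ht, hN _ _ (hle.trans (Nat.le_mul_of_pos_left t (hd _))) (dvd_mul_right _ _)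
      (Nat.mul_pos (hd _) ht)⟩
  · ext x
    simp only [Set.Finite.coe_toFinset, Set.mem_union, Set.mem_iUnion, Set.mem_image,
      Set.mem_ofPred_eq]
    constructor
    · intro hx
      obtain ⟨i, hi⟩ := Set.mem_iUnion.1 (hL ▸ hx)
      by_cases hc : (M i).Finite
      · exact Or.inl ⟨⟨i, hc⟩, hi⟩
      · obtain ⟨t, rfl⟩ := hdvd ⟨i, hc⟩ x hi
        refine Or.inr ⟨φ ⟨i, hc⟩, t, ?_, ?_⟩ <;> rw [Equiv.symm_apply_apply]
        exact ⟨Nat.pos_of_mul_pos_left (hpos _ hx), hx⟩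
    · rintro (⟨i, hi⟩ | ⟨k, t, ⟨-, ht⟩, rfl⟩)
      · exact hL ▸ Set.mem_iUnion.2 ⟨i, hi⟩
      · exact ht

section Recoding

variable {Ω : Type*}

/-- Passing to windows of length `2 N + 1` recodes a one-step shift of finite type as the walks
along a relation on windows. -/
theorem exists_isWalkFactor_windows {A : Type*} {e : Equiv.Perm Ω} {R : A → A → Prop}
    {π : (ℤ → A) → Ω} (hP : IsWalkFactor e R π) (N : ℕ) :
    ∃ (R' : (Set.Icc (-N : ℤ) N → A) → (Set.Icc (-N : ℤ) N → A) → Prop)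
      (π' : (ℤ → Set.Icc (-N : ℤ) N → A) → Ω), IsWalkFactor e R' π' ∧
      ∀ x ∈ walks R', ∀ y ∈ walks R', x 0 = y 0 →
        ∃ x' ∈ walks R, ∃ y' ∈ walks R, (∀ t : ℤ, |t| ≤ N → x' t = y' t) ∧
          π' x = π x' ∧ π' y = π y' := by
  have h0 : (0 : ℤ) ∈ Set.Icc (-N : ℤ) N := by simp
  let R' : (Set.Icc (-N : ℤ) N → A) → (Set.Icc (-N : ℤ) N → A) → Prop := fun a b =>
    ∃ x ∈ walks R, (∀ t, a t = x t) ∧ ∀ t, b t = x (t + 1)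
  have hmem : ∀ y ∈ walks R', (fun i => y i ⟨0, h0⟩) ∈ walks R := by
    intro y hy i
    obtain ⟨x, hx, h1, h2⟩ := hy i
    simpa only [h1, h2] using hx 0
  have hstep : ∀ y ∈ walks R', ∀ (i t : ℤ) (ht : t ∈ Set.Icc (-N : ℤ) N)
      (ht' : t + 1 ∈ Set.Icc (-N : ℤ) N), y i ⟨t + 1, ht'⟩ = y (i + 1) ⟨t, ht⟩ := by
    intro y hy i t ht ht'
    obtain ⟨x, hx, h1, h2⟩ := hy i
    rw [h1, h2]
  have hwin : ∀ y ∈ walks R', ∀ (t : ℤ) (ht : t ∈ Set.Icc (-N : ℤ) N) (i : ℤ),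
      y i ⟨t, ht⟩ = y (i + t) ⟨0, h0⟩ := by
    intro y hy t
    induction t using Int.induction_on with
    | zero => simp
    | succ t ih =>
      intro ht i
      have ht1 : (t : ℤ) ∈ Set.Icc (-N : ℤ) N := by
        simp only [Set.mem_Icc] at ht ⊢; omega
      rw [hstep y hy i t ht1 ht, ih, add_assoc, add_comm 1 (t : ℤ)]
    | pred t ih =>
      intro ht i
      have ht1 : (-t : ℤ) ∈ Set.Icc (-N : ℤ) N := by
        simp only [Set.mem_Icc] at ht ⊢; omega
      have h1 := ih ht1 (i - 1)
      have h2 := hstep y hy (i - 1) (-t - 1) ht (by simpa using ht1)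
      simp only [sub_add_cancel] at h2
      rw [← h2, h1]
      congr 1
      ring
  refine ⟨R', fun y => π fun i => y i ⟨0, h0⟩, ⟨fun ω => ?_, fun y hy n => ?_⟩, ?_⟩
  · obtain ⟨x, hx, rfl⟩ := hP.surj ω
    refine ⟨fun i t => x (i + t), fun i => ?_, by simp⟩
    refine ⟨fun t => x (t + i), walks_shift hx i, fun t => ?_, fun t => ?_⟩
    · exact congrArg x (add_comm _ _)
    · exact congrArg x (by ring)
  · exact hP.equivariant _ (hmem y hy) n
  · intro x hx y hy hxy
    refine ⟨_, hmem x hx, _, hmem y hy, fun t ht => ?_, rfl, rfl⟩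
    rw [abs_le] at ht
    have h1 := hwin x hx t ht 0
    have h2 := hwin y hy t ht 0
    rw [zero_add] at h1 h2
    rw [← h1, ← h2, hxy]

theorem isClosed_walks {A : Type*} [TopologicalSpace A] [DiscreteTopology A]
    (R : A → A → Prop) : IsClosed (walks R) := by
  have : walks R = ⋂ i : ℤ, (fun x : ℤ → A => (x i, x (i + 1))) ⁻¹' {p | R p.1 p.2} := by
    ext x; simp [walks]
  rw [this]
  exact isClosed_iInter fun i => (isClosed_discrete _).preimage (by fun_prop)

/-- A continuous map on a closed subset of a full shift is uniformly continuous. -/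
theorem exists_window_dist_lt {A : Type*} [TopologicalSpace A] [DiscreteTopology A] [Finite A]
    [MetricSpace Ω] {X : Set (ℤ → A)} (hX : IsClosed X) {π : (ℤ → A) → Ω}
    (hπ : ContinuousOn π X) {δ : ℝ} (hδ : 0 < δ) :
    ∃ N : ℕ, ∀ x ∈ X, ∀ y ∈ X, (∀ t : ℤ, |t| ≤ N → x t = y t) → dist (π x) (π y) < δ := by
  have hg : ContinuousOn (fun p : (ℤ → A) × (ℤ → A) => dist (π p.1) (π p.2)) (X ×ˢ X) :=
    continuous_dist.comp_continuousOn
      ((hπ.comp continuousOn_fst fun _ hp => hp.1).prodMk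
        (hπ.comp continuousOn_snd fun _ hp => hp.2))
  have hK : IsCompact ((X ×ˢ X) ∩
      (fun p : (ℤ → A) × (ℤ → A) => dist (π p.1) (π p.2)) ⁻¹' Set.Ici δ) :=
    (hg.preimage_isClosed_of_isClosed (hX.prod hX) isClosed_Ici).isCompact
  obtain ⟨F, hF⟩ := hK.elim_finite_subfamily_closed
    (fun i : ℤ => {p : (ℤ → A) × (ℤ → A) | p.1 i = p.2 i})
    (fun i => isClosed_eq (by fun_prop) (by fun_prop)) (by
      rw [Set.eq_empty_iff_forall_notMem]
      rintro ⟨x, y⟩ ⟨⟨-, hxy⟩, h⟩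
      have : x = y := funext fun i => by simpa using Set.mem_iInter.1 h i
      subst this
      simp only [Set.mem_preimage, dist_self, Set.mem_Ici] at hxy
      exact absurd hδ (not_lt.2 hxy))
  refine ⟨F.sup Int.natAbs, fun x hx y hy hxy => ?_⟩
  by_contra! hc
  refine (Set.eq_empty_iff_forall_notMem.1 hF) (x, y) ⟨⟨⟨hx, hy⟩, hc⟩, ?_⟩
  simp only [Set.mem_iInter]
  intro i hi
  refine hxy i ?_
  have := Finset.le_sup (f := Int.natAbs) hi
  rw [Int.abs_eq_natAbs]
  exact_mod_cast this

/-- A finitely presented system is a factor of shifts of finite type whose cylinders of length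
one have arbitrarily small images. -/
theorem IsFPSystem.exists_isWalkFactor [MetricSpace Ω] [CompactSpace Ω] {f : Ω ≃ₜ Ω}
    (hFP : IsFPSystem f) {δ : ℝ} (hδ : 0 < δ) :
    ∃ (V : Type) (_ : Fintype V) (R : V → V → Prop) (π : (ℤ → V) → Ω),
      IsWalkFactor f.toEquiv R π ∧
      ∀ x ∈ walks R, ∀ y ∈ walks R, x 0 = y 0 → dist (π x) (π y) < δ := by
  classical
  obtain ⟨-, m, X, π, ⟨R, rfl⟩, hπ, hsurj, heq⟩ := hFP
  have hP : IsWalkFactor f.toEquiv (fun a b => (a, b) ∈ R) π := by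
    refine ⟨fun ω => ?_, fun x hx n => ?_⟩
    · have : ω ∈ π '' _ := hsurj ▸ Set.mem_univ ω
      exact this
    · have hshift : ∀ k : ℤ, π (fun i => x (i + (k + 1))) = f (π fun i => x (i + k)) := by
        intro k
        rw [← heq _ (walks_shift hx k)]
        congr 1
        funext i
        simp only [shiftMap]
        congr 1
        ring
      induction n using Int.induction_on with
      | zero => simp
      | succ n ih =>
        rw [hshift, ih, add_comm, zpow_add, zpow_one]
        rfl
      | pred n ih =>
        have h1 := hshift (-n - 1)
        rw [sub_add_cancel, ih] at h1
        apply f.injective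
        rw [← h1]
        conv_lhs => rw [show (-n : ℤ) = 1 + (-n - 1) by ring, zpow_add, zpow_one]
        rfl
  obtain ⟨N, hN⟩ := exists_window_dist_lt (isClosed_walks fun a b => (a, b) ∈ R) hπ hδ
  obtain ⟨R', π', hP', h⟩ := exists_isWalkFactor_windows hP N
  refine ⟨_, inferInstance, R', π', hP', fun x hx y hy hxy => ?_⟩
  obtain ⟨x', hx', y', hy', hxy', h1, h2⟩ := h x hx y hy hxy
  rw [h1, h2]
  exact hN x' hx' y' hy' hxy'

theorem IsFPSystem.exists_isFinitePresentation [MetricSpace Ω] [CompactSpace Ω] {f : Ω ≃ₜ Ω}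
    (hFP : IsFPSystem f) :
    ∃ (V : Type) (_ : Fintype V) (R S : V → V → Prop) (π : (ℤ → V) → Ω),
      IsFinitePresentation f.toEquiv R S π := by
  obtain ⟨ε, hε, hexp⟩ := hFP.1
  obtain ⟨V, hV, R, π, hP, hδ⟩ := hFP.exists_isWalkFactor (half_pos hε)
  refine ⟨V, hV, R, fun a b => ∃ x ∈ walks R, ∃ y ∈ walks R, x 0 = a ∧ y 0 = b ∧ π x = π y, π,
    ⟨hP, fun x hx y hy => ⟨fun h i => ?_, fun h => ?_⟩⟩⟩
  · refine ⟨_, walks_shift hx i, _, walks_shift hy i, by simp, by simp, ?_⟩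
    rw [hP.equivariant x hx, hP.equivariant y hy, h]
  · by_contra hne
    obtain ⟨n, hn⟩ := hexp _ _ hne
    obtain ⟨x', hx', y', hy', h1, h2, h3⟩ := h n
    rw [← hP.equivariant x hx, ← hP.equivariant y hy] at hn
    have d1 := hδ x' hx' _ (walks_shift hx n) (by simpa using h1)
    have d2 := hδ y' hy' _ (walks_shift hy n) (by simpa using h2)
    have d3 := dist_triangle (π fun i => x (i + n)) (π x') (π fun i => y (i + n))
    rw [dist_comm] at d1
    rw [← h3] at d2
    linarith

end Recoding

section Transitivity

variable {Ω : Type*}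

/-- In a transitive system some nonempty open set of points visits a given nonempty open set
arbitrarily many times. -/
theorem TopTrans.exists_many_visits [TopologicalSpace Ω] {f : Ω → Ω} (hf : Continuous f)
    (h : TopTrans f) {U : Set Ω} (hU : IsOpen U) (hne : U.Nonempty) (k : ℕ) :
    ∃ (y : Ω) (T : Finset ℕ), k < T.card ∧ ∀ t ∈ T, f^[t] y ∈ U := by
  suffices ∃ (W : Set Ω) (T : Finset ℕ), IsOpen W ∧ W.Nonempty ∧ k < T.card ∧
      ∀ y ∈ W, ∀ t ∈ T, f^[t] y ∈ U by
    obtain ⟨W, T, -, ⟨y, hy⟩, hT, hW⟩ := this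
    exact ⟨y, T, hT, hW y hy⟩
  induction k with
  | zero => exact ⟨U, {0}, hU, hne, by simp, by simp⟩
  | succ k ih =>
    obtain ⟨W, T, hWo, hWne, hT, hW⟩ := ih
    obtain ⟨n, hn, hne'⟩ := h U W hU hWo hne hWne
    refine ⟨U ∩ f^[n] ⁻¹' W, insert 0 (T.map (addRightEmbedding n)),
      hU.inter (hWo.preimage (hf.iterate n)), hne', ?_, ?_⟩
    · rw [Finset.card_insert_of_notMem, Finset.card_map]
      · omega
      · simp only [Finset.mem_map, addRightEmbedding_apply, not_exists, not_and]
        omega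
    · rintro y ⟨hyU, hyW⟩ t ht
      rcases Finset.mem_insert.1 ht with rfl | ht
      · exact hyU
      · obtain ⟨t, ht', rfl⟩ := Finset.mem_map.1 ht
        rw [addRightEmbedding_apply, Function.iterate_add_apply]
        exact hW _ hyW t ht'

/-- A transitive finitely presented system with finitely many periodic points consists of
periodic points. -/
theorem IsFPSystem.periodicPts_eq_univ [MetricSpace Ω] [CompactSpace Ω] {f : Ω ≃ₜ Ω}
    (hFP : IsFPSystem f) (htrans : TopTrans f) (hfin : (Function.periodicPts f).Finite) :
    Function.periodicPts f = Set.univ := by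
  by_contra hne
  obtain ⟨ω, hω⟩ := (Set.ne_univ_iff_exists_notMem _).1 hne
  obtain ⟨δ, hδ, hball⟩ := Metric.isOpen_iff.1 hfin.isClosed.isOpen_compl ω hω
  obtain ⟨V, hV, R, π, hP, hcell⟩ := hFP.exists_isWalkFactor (half_pos hδ)
  obtain ⟨y, T, hT, hyT⟩ := htrans.exists_many_visits f.continuous Metric.isOpen_ball
    ⟨ω, Metric.mem_ball_self (half_pos hδ)⟩ (Fintype.card V)
  obtain ⟨x, hx, rfl⟩ := hP.surj y
  obtain ⟨s, hs, t, -, hst, hxst⟩ : ∃ s ∈ T, ∃ t ∈ T, s < t ∧ x s = x t := by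
    obtain ⟨s, hs, t, ht, hst, hxst⟩ := Finset.exists_ne_map_eq_of_card_lt_of_maps_to
      (t := Finset.univ) (f := fun j : ℕ => x j) (by simpa using hT) (by simp)
    rcases lt_or_gt_of_ne hst with h | h
    · exact ⟨s, hs, t, ht, h, hxst⟩
    · exact ⟨t, ht, s, hs, h, hxst.symm⟩
  have hn : (0 : ℤ) < (t - s : ℕ) := by omega
  have hz := periodize_mem_walks hx (a := s) hn (by
    rw [hxst]; congr 1; omega)
  have hper := hP.isPeriodicPt_of_periodic hz (n := t - s) (by simp)
  refine hball ?_ (Function.mk_mem_periodicPts (by omega) hper)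
  have h1 := hcell _ hz _ (walks_shift hx s) (by simp)
  rw [hP.equivariant x hx, zpow_natCast, ← Equiv.Perm.iterate_eq_pow] at h1
  have h2 : dist (f^[s] (π x)) ω < δ / 2 := hyT s hs
  have h3 := dist_triangle (π fun i => x (s + i % (t - s : ℕ))) (f^[s] (π x)) ω
  rw [Metric.mem_ball]
  have h4 : dist (π fun i => x (s + i % (t - s : ℕ))) (f^[s] (π x)) < δ / 2 := h1
  linarith

theorem TopTrans.exists_iterate_eq [TopologicalSpace Ω] [DiscreteTopology Ω] {f : Ω → Ω}
    (h : TopTrans f) (x y : Ω) : ∃ n, f^[n] x = y := by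
  obtain ⟨n, -, z, rfl, hz⟩ := h {x} {y} (isOpen_discrete _) (isOpen_discrete _) ⟨x, rfl⟩ ⟨y, rfl⟩
  exact ⟨n, hz⟩

theorem mem_leastPeriodSet_iff {f : Ω → Ω} {n : ℕ} :
    n ∈ leastPeriodSet f ↔ 0 < n ∧ ∃ x, Function.minimalPeriod f x = n := by
  refine and_congr_right fun hn => exists_congr fun x => ⟨fun ⟨h, hlt⟩ => ?_, ?_⟩
  · refine ((Function.IsPeriodicPt.minimalPeriod_le hn h).lt_or_eq).resolve_left fun hc => ?_
    exact hlt _ (Function.IsPeriodicPt.minimalPeriod_pos hn h) hc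
      (Function.isPeriodicPt_minimalPeriod f x)
  · rintro rfl
    exact ⟨Function.isPeriodicPt_minimalPeriod f x, fun k hk hlt =>
      Function.not_isPeriodicPt_of_pos_of_lt_minimalPeriod hk.ne' hlt⟩

/-- A transitive finitely presented system with finitely many least periods is a single periodic
orbit. -/
theorem IsFPSystem.leastPeriodSet_eq_singleton_of_finite [MetricSpace Ω] [CompactSpace Ω]
    [Nonempty Ω] {f : Ω ≃ₜ Ω} (hFP : IsFPSystem f) (htrans : TopTrans f)
    (hfin : (leastPeriodSet f).Finite) : ∃ d, leastPeriodSet f = {d} := by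
  obtain ⟨V, hV, R, S, π, hP⟩ := hFP.exists_isFinitePresentation
  have hpts : (Function.periodicPts f).Finite := by
    refine (hfin.biUnion fun n hn => hP.finite_isPeriodicPt hn.1).subset fun x hx => ?_
    refine Set.mem_biUnion (x := Function.minimalPeriod f x)
      (mem_leastPeriodSet_iff.2 ⟨Function.minimalPeriod_pos_of_mem_periodicPts hx, x, rfl⟩) ?_
    exact Function.isPeriodicPt_minimalPeriod f x
  have huniv := hFP.periodicPts_eq_univ htrans hpts
  have : Finite Ω := Set.finite_univ_iff.1 (huniv ▸ hpts)
  obtain ⟨x⟩ := ‹Nonempty Ω›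
  have hx : x ∈ Function.periodicPts f := huniv ▸ Set.mem_univ x
  refine ⟨Function.minimalPeriod f x, Set.ext fun n => ?_⟩
  rw [mem_leastPeriodSet_iff, Set.mem_singleton_iff]
  constructor
  · rintro ⟨-, y, rfl⟩
    obtain ⟨k, rfl⟩ := htrans.exists_iterate_eq x y
    exact Function.minimalPeriod_apply_iterate hx k
  · rintro rfl
    exact ⟨Function.minimalPeriod_pos_of_mem_periodicPts hx, x, rfl⟩

end Transitivity

/-- The least period set of a topologically transitive finitely presented system is
either a singleton, or a union `F ∪ ⋃_{i=1}^n dᵢ Sᵢ` with `F` finite, `n ≥ 1` and each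
`Sᵢ` cofinite (so at least one cofinite set `dᵢSᵢ` appears). -/
theorem LPS_of_transitive_FP {Ω : Type*} [MetricSpace Ω] [CompactSpace Ω] [Nonempty Ω]
    (f : Ω ≃ₜ Ω) (hFP : IsFPSystem f) (htrans : TopTrans (⇑f)) :
    (∃ d : ℕ, leastPeriodSet (⇑f) = {d}) ∨
    (∃ (F : Finset ℕ) (n : ℕ) (d : Fin n → ℕ) (S : Fin n → Set ℕ),
      0 < n ∧ (∀ m ∈ F, 0 < m) ∧ (∀ i, 0 < d i) ∧ (∀ i, CofinitePos (S i)) ∧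
      leastPeriodSet (⇑f) = ↑F ∪ ⋃ i : Fin n, (fun s => d i * s) '' S i) := by
  rcases (leastPeriodSet f).finite_or_infinite with hfin | hinf
  · exact Or.inl (hFP.leastPeriodSet_eq_singleton_of_finite htrans hfin)
  · right
    obtain ⟨V, hV, R, S, π, hP⟩ := hFP.exists_isFinitePresentation
    have : NeZero (Fintype.card V).factorial := ⟨Nat.factorial_ne_zero _⟩
    refine exists_finset_union_mul_cofinite
      (M := fun s : ZMod (Fintype.card V).factorial → V => loopPeriods f.toEquiv R S π s)
      (fun n hn => hn.1) hinf ?_ fun s hs => ?_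
    · ext n
      rw [mem_leastPeriodSet_iff, Set.mem_iUnion]
      constructor
      · rintro ⟨hn, ω, rfl⟩
        exact hP.exists_mem_loopPeriods ω hn
      · rintro ⟨s, hn, c, W, -, h⟩
        exact ⟨hn, _, h⟩
    · obtain ⟨d, hd, hdvd, N, hN⟩ := hP.exists_dvd_of_infinite_loopPeriods s hs
      exact ⟨d, hd, hdvd, N, fun m hm hdm hm0 => mem_leastPeriodSet_iff.2 ⟨hm0, hN m hm hdm⟩⟩
end

section
/- Let (Ω, f) be a topologically mixing finitely presented (FP) system with Ω nonempty. Then LPS(f) is either the singleton {1} or a cofinite subset of ℕ. -/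
/-- Topological mixing of a map `f` on a topological space. -/
def TopMixing {Ω : Type*} [TopologicalSpace Ω] (f : Ω → Ω) : Prop :=
  ∀ U V : Set Ω, IsOpen U → IsOpen V → U.Nonempty → V.Nonempty →
    ∃ N : ℕ, ∀ n : ℕ, N ≤ n → (U ∩ f^[n] ⁻¹' V).Nonempty

/-- The bi-infinite paths of the relation `R`. -/
def biPaths {B : Type*} (R : B → B → Prop) : Set (ℤ → B) :=
  {x | ∀ i, R (x i) (x (i + 1))}

/-- The image under `π` of the bi-infinite `R`-paths whose zeroth symbol is `s`. -/
def cylImage {B Ω : Type*} (R : B → B → Prop) (π : (ℤ → B) → Ω) (s : B) : Set Ω :=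
  π '' {x | x ∈ biPaths R ∧ x 0 = s}

theorem exists_int_orbit {T : Type*} [Finite T] [Nonempty T] (φ : T → T) :
    ∃ e : ℤ → T, ∀ k, e (k + 1) = φ (e k) := by
  obtain ⟨t⟩ := ‹Nonempty T›
  obtain ⟨a, b, hab, h⟩ := Set.finite_univ.exists_lt_map_eq_of_forall_mem
    (f := fun n : ℕ => φ^[n] t) (fun _ => Set.mem_univ _)
  have hc : (0 : ℤ) < (b - a : ℕ) := by omega
  generalize hcdef : b - a = c at hc
  have hper : φ^[c] (φ^[a] t) = φ^[a] t := by
    rw [← Function.iterate_add_apply, ← hcdef, Nat.sub_add_cancel hab.le]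
    exact h.symm
  refine ⟨fun k => φ^[(k % c).toNat] (φ^[a] t), fun k => ?_⟩
  have h0 := Int.emod_nonneg k hc.ne'
  have h1 := Int.emod_lt_of_pos k hc
  simp only
  rw [← Function.iterate_succ_apply' φ]
  by_cases hk : k % c + 1 = c
  · have : (k + 1) % c = 0 := by rw [← Int.emod_add_emod, hk, Int.emod_self]
    have h2 : (k % c).toNat.succ = c := by omega
    rw [this, h2, hper]
    rfl
  · have : (k + 1) % c = k % c + 1 := by
      rw [← Int.emod_add_emod]
      exact Int.emod_eq_of_lt (by omega) (by omega)
    rw [this]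
    congr 1
    rw [show (k % c + 1).toNat = (k % c).toNat.succ by omega]

theorem map_shift_zpow {B Ω : Type*} {R : B → B → Prop} {π : (ℤ → B) → Ω} {F : Equiv.Perm Ω}
    (hπ : ∀ x ∈ biPaths R, π (shiftMap x) = F (π x)) {x : ℤ → B} (hx : x ∈ biPaths R) (k : ℤ) :
    π (fun j => x (j + k)) = (F ^ k) (π x) := by
  have hmem : ∀ k : ℤ, (fun j => x (j + k)) ∈ biPaths R := fun k i => by
    have := hx (i + k)
    rwa [add_right_comm] at this
  have step : ∀ k : ℤ, π (fun j => x (j + (k + 1))) = F (π (fun j => x (j + k))) := fun k => by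
    rw [← hπ _ (hmem k)]
    congr 1
    funext j
    simp only [shiftMap]
    congr 1
    ring
  induction k with
  | zero => simp
  | succ k ih => rw [step, ih, add_comm (k : ℤ), zpow_add, zpow_one, Equiv.Perm.mul_apply]
  | pred k ih =>
    have := step (-(k : ℤ) - 1)
    rw [sub_add_cancel, ih] at this
    apply F.injective
    rw [← this, ← Equiv.Perm.mul_apply, ← zpow_one_add]
    congr 2
    ring

/-- Some nonempty open set is contained in or disjoint from each member of a finite family of
closed sets. -/
theorem exists_open_subset_or_disjoint {B Ω : Type*} [TopologicalSpace Ω] [Nonempty Ω]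
    {C : B → Set Ω} (hC : ∀ s, IsClosed (C s)) (F : Finset B) :
    ∃ U : Set Ω, IsOpen U ∧ U.Nonempty ∧ ∀ s ∈ F, U ⊆ C s ∨ ∀ u ∈ U, u ∉ C s := by
  classical
  induction F using Finset.induction_on with
  | empty => exact ⟨Set.univ, isOpen_univ, Set.univ_nonempty, by simp⟩
  | insert s F _ ih =>
    obtain ⟨U, hU, hne, h⟩ := ih
    by_cases hs : U ⊆ C s
    · refine ⟨U, hU, hne, fun t ht => ?_⟩
      rcases Finset.mem_insert.1 ht with rfl | ht
      · exact Or.inl hs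
      · exact h t ht
    · obtain ⟨u, hu, hus⟩ := Set.not_subset.1 hs
      refine ⟨U \ C s, hU.sdiff (hC s), ⟨u, hu, hus⟩, fun t ht => ?_⟩
      rcases Finset.mem_insert.1 ht with rfl | ht
      · exact Or.inr fun v hv => hv.2
      · exact (h t ht).imp (fun h' => Set.sdiff_subset.trans h') (fun h' v hv => h' v hv.1)

theorem isCompact_biPaths {B : Type*} [Finite B] [TopologicalSpace B] [DiscreteTopology B]
    (R : B → B → Prop) : IsCompact (biPaths R) := by
  have : IsClosed (biPaths R) := by
    have h : biPaths R = ⋂ i : ℤ, (fun x : ℤ → B => (x i, x (i + 1))) ⁻¹' {p | R p.1 p.2} := by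
      ext x
      simp [biPaths]
    rw [h]
    exact isClosed_iInter fun i => (isClosed_discrete _).preimage (by fun_prop)
  exact this.isCompact

/-- A continuous map on a compact set of sequences depends, up to `δ`, on a finite window. -/
theorem exists_window {A Ω : Type*} [TopologicalSpace A] [T2Space A] [MetricSpace Ω]
    {X : Set (ℤ → A)} (hX : IsCompact X) {π : (ℤ → A) → Ω} (hπ : ContinuousOn π X)
    {δ : ℝ} (hδ : 0 < δ) :
    ∃ K : ℕ, ∀ x ∈ X, ∀ y ∈ X, (∀ i : ℤ, |i| ≤ K → x i = y i) → dist (π x) (π y) < δ := by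
  let D : Set ((ℤ → A) × (ℤ → A)) :=
    (X ×ˢ X) ∩ (fun p => dist (π p.1) (π p.2)) ⁻¹' Set.Ici δ
  have hXX := hX.prod hX
  have hcont : ContinuousOn (fun p : (ℤ → A) × (ℤ → A) => dist (π p.1) (π p.2)) (X ×ˢ X) :=
    continuous_dist.comp_continuousOn ((hπ.comp continuousOn_fst fun _ hp => hp.1).prodMk
      (hπ.comp continuousOn_snd fun _ hp => hp.2))
  have hD : IsCompact D := hXX.of_isClosed_subset
    (hcont.preimage_isClosed_of_isClosed hXX.isClosed isClosed_Ici) Set.inter_subset_left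
  obtain ⟨K, hK⟩ := hD.elim_directed_cover
    (fun K : ℕ => ⋃ i : ℤ, ⋃ _ : |i| ≤ K, {p : (ℤ → A) × (ℤ → A) | p.1 i ≠ p.2 i})
    (fun K => isOpen_iUnion fun i => isOpen_iUnion fun _ =>
      isOpen_ne_fun (by fun_prop) (by fun_prop))
    (by
      rintro ⟨x, y⟩ ⟨_, hxy⟩
      have hne : x ≠ y := by
        rintro rfl
        simp only [Set.mem_preimage, dist_self, Set.mem_Ici] at hxy
        linarith
      obtain ⟨i, hi⟩ := Function.ne_iff.1 hne
      simp only [Set.mem_iUnion]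
      exact ⟨i.natAbs, i, by simp, hi⟩)
    (by
      refine directed_of_isDirected_le fun K L hKL => ?_
      refine Set.iUnion_mono fun i => Set.iUnion_mono' fun hi => ⟨?_, subset_rfl⟩
      exact hi.trans (by exact_mod_cast hKL))
  refine ⟨K, fun x hx y hy h => ?_⟩
  by_contra hlt
  have := hK (show (x, y) ∈ D from ⟨⟨hx, hy⟩, not_lt.1 hlt⟩)
  simp only [Set.mem_iUnion] at this
  obtain ⟨i, hi, hne⟩ := this
  exact hne (h i hi)

/-- A factor of a one-step SFT can be recoded so that the images of the cylinder sets at the zeroth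
coordinate are closed sets of small diameter. -/
theorem exists_fine_presentation {Ω : Type*} [MetricSpace Ω] (f : Ω → Ω)
    {m : ℕ} {X : Set (ℤ → Fin m)} {π : (ℤ → Fin m) → Ω} (hX : IsOneStepSFT X)
    (hπ : ContinuousOn π X) (hsurj : π '' X = Set.univ)
    (heq : ∀ x ∈ X, π (shiftMap x) = f (π x)) {δ : ℝ} (hδ : 0 < δ) :
    ∃ (B : Type) (_ : Finite B) (R : B → B → Prop) (ρ : (ℤ → B) → Ω),
      (∀ s, IsClosed (cylImage R ρ s)) ∧ (∀ p, ∃ s, p ∈ cylImage R ρ s) ∧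
      (∀ x ∈ biPaths R, ρ (shiftMap x) = f (ρ x)) ∧
      ∀ s, ∀ p ∈ cylImage R ρ s, ∀ q ∈ cylImage R ρ s, dist p q ≤ δ := by
  obtain ⟨Q, rfl⟩ := hX
  set X : Set (ℤ → Fin m) := {x | ∀ i : ℤ, (x i, x (i + 1)) ∈ Q} with hXdef
  have hXc : IsCompact X := isCompact_biPaths fun a b => (a, b) ∈ Q
  obtain ⟨K, hK⟩ := exists_window hXc hπ hδ
  let I : Type := Set.Icc (-(K : ℤ)) K
  let blk : (ℤ → Fin m) → ℤ → I → Fin m := fun x i j => x (i + j.1)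
  let o : I := ⟨0, by simp⟩
  let R : (I → Fin m) → (I → Fin m) → Prop := fun b c => ∃ x ∈ X, b = blk x 0 ∧ c = blk x 1
  let D : (ℤ → I → Fin m) → ℤ → Fin m := fun y i => y i o
  have hshift : ∀ x ∈ X, ∀ k : ℤ, (fun i => x (i + k)) ∈ X := fun x hx k i => by
    have := hx (i + k)
    rwa [add_right_comm] at this
  have hblk : ∀ x ∈ X, blk x ∈ biPaths R := fun x hx i => by
    refine ⟨fun j => x (j + i), hshift x hx i, ?_, ?_⟩ <;> funext j <;> simp only [blk] <;>
      congr 1 <;> ring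
  have hDblk : ∀ x, D (blk x) = x := fun x => by
    funext i
    simp [D, blk, o]
  have hDX : ∀ y ∈ biPaths R, D y ∈ X := fun y hy i => by
    obtain ⟨x, hx, h0, h1⟩ := hy i
    have := hx 0
    simpa [D, h0, h1, blk, o] using this
  have hblkD : ∀ y ∈ biPaths R, ∀ i, y i = blk (D y) i := fun y hy => by
    have step : ∀ i (j j' : I), j'.1 = j.1 + 1 → y i j' = y (i + 1) j := fun i j j' hj => by
      obtain ⟨x, -, h0, h1⟩ := hy i
      rw [h0, h1]
      simp only [blk, hj]
      congr 1
      ring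
    have key : ∀ (n : ℕ) (i : ℤ),
        (∀ h : (n : ℤ) ∈ Set.Icc (-(K : ℤ)) K, y i ⟨n, h⟩ = D y (i + n)) ∧
        (∀ h : -(n : ℤ) ∈ Set.Icc (-(K : ℤ)) K, y i ⟨-n, h⟩ = D y (i - n)) := by
      intro n
      induction n with
      | zero => intro i; constructor <;> intro h <;> simp [D, o]
      | succ n ih =>
        intro i
        constructor <;> intro h
        · have hn : (n : ℤ) ∈ Set.Icc (-(K : ℤ)) K := by
            simp only [Set.mem_Icc] at h ⊢
            omega
          rw [step i ⟨n, hn⟩ _ (by simp), (ih (i + 1)).1]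
          congr 1
          push_cast
          ring
        · have hn : -(n : ℤ) ∈ Set.Icc (-(K : ℤ)) K := by
            simp only [Set.mem_Icc] at h ⊢
            omega
          have := step (i - 1) ⟨_, h⟩ ⟨-n, hn⟩ (by simp)
          rw [sub_add_cancel] at this
          rw [← this, (ih (i - 1)).2]
          congr 1
          push_cast
          ring
    intro i
    funext ⟨j, hj⟩
    obtain ⟨n, rfl | rfl⟩ := j.eq_nat_or_neg
    · exact (key n i).1 hj
    · exact (key n i).2 hj
  have hcyl : ∀ s, cylImage R (fun y => π (D y)) s = π '' {x | x ∈ X ∧ blk x 0 = s} := fun s => by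
    ext p
    constructor
    · rintro ⟨y, ⟨hy, h0⟩, rfl⟩
      exact ⟨D y, ⟨hDX y hy, by rw [← hblkD y hy, h0]⟩, rfl⟩
    · rintro ⟨x, ⟨hx, h0⟩, rfl⟩
      exact ⟨blk x, ⟨hblk x hx, h0⟩, by simp only [hDblk]⟩
  refine ⟨I → Fin m, inferInstance, R, fun y => π (D y), fun s => ?_, fun p => ?_, fun y hy => ?_,
    fun s p hp q hq => ?_⟩
  · rw [hcyl]
    have hc : IsCompact {x | x ∈ X ∧ blk x 0 = s} := by
      refine hXc.inter_right (?_ : IsClosed {x | blk x 0 = s})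
      exact isClosed_eq (by fun_prop) continuous_const
    exact (hc.image_of_continuousOn (hπ.mono fun x hx => hx.1)).isClosed
  · obtain ⟨x, hx, rfl⟩ : p ∈ π '' X := hsurj ▸ Set.mem_univ p
    exact ⟨blk x 0, by rw [hcyl]; exact ⟨x, ⟨hx, rfl⟩, rfl⟩⟩
  · exact heq _ (hDX y hy)
  · rw [hcyl] at hp hq
    obtain ⟨x, ⟨hx, hx0⟩, rfl⟩ := hp
    obtain ⟨y, ⟨hy, hy0⟩, rfl⟩ := hq
    refine (hK x hx y hy fun i hi => ?_).le
    have := congrFun (hx0.trans hy0.symm) ⟨i, abs_le.1 hi⟩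
    simpa [blk] using this

/-- A finitely presented system has a nonempty open set `U` such that every periodic pseudo-orbit
all of whose jumps take place inside `U` is shadowed by a periodic orbit. -/
theorem exists_open_periodic_shadowing {Ω : Type*} [MetricSpace Ω] [CompactSpace Ω] [Nonempty Ω]
    {f : Ω ≃ₜ Ω} (hFP : IsFPSystem f) {ε : ℝ} (hε : 0 < ε)
    (hexp : ∀ x y : Ω, x ≠ y → ∃ n : ℤ, ε < dist ((f.toEquiv ^ n) x) ((f.toEquiv ^ n) y)) :
    ∃ U : Set Ω, IsOpen U ∧ U.Nonempty ∧ ∀ n : ℕ, 0 < n → ∀ z : ZMod n → Ω,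
      (∀ i, z (i + 1) = f (z i) ∨ f (z i) ∈ U ∧ z (i + 1) ∈ U) →
      ∃ p, f^[n] p = p ∧ ∀ k : ℕ, dist (f^[k] p) (z k) ≤ ε / 2 := by
  obtain ⟨-, m, X, π, hX, hπ, hsurj, heq⟩ := hFP
  obtain ⟨B, hB, R, ρ, hclosed, hcover, hequiv, hdiam⟩ :=
    exists_fine_presentation f hX hπ hsurj heq (half_pos hε)
  have := Fintype.ofFinite B
  obtain ⟨U, hU, hne, hUC⟩ := exists_open_subset_or_disjoint hclosed Finset.univ
  refine ⟨U, hU, hne, fun n hn z hz => ?_⟩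
  have : NeZero n := ⟨hn.ne'⟩
  have hnext : ∀ q : {q : ZMod n × B // z q.1 ∈ cylImage R ρ q.2},
      ∃ t, R q.1.2 t ∧ z (q.1.1 + 1) ∈ cylImage R ρ t := by
    rintro ⟨⟨i, s⟩, hq⟩
    obtain ⟨x, ⟨hx, rfl⟩, hxz⟩ : z i ∈ cylImage R ρ s := hq
    have hf : f (z i) ∈ cylImage R ρ (x 1) := by
      refine ⟨shiftMap x, ⟨fun j => hx (j + 1), by simp [shiftMap]⟩, ?_⟩
      rw [hequiv x hx, hxz]
    refine ⟨x 1, by simpa using hx 0, ?_⟩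
    rcases hz i with h | ⟨h1, h2⟩
    · simpa only [h] using hf
    · rcases hUC (x 1) (Finset.mem_univ _) with h | h
      · exact h h2
      · exact absurd hf (h _ h1)
  choose t htR htz using hnext
  have : Nonempty {q : ZMod n × B // z q.1 ∈ cylImage R ρ q.2} := by
    obtain ⟨s, hs⟩ := hcover (z 0)
    exact ⟨⟨(0, s), hs⟩⟩
  obtain ⟨e, he⟩ := exists_int_orbit
    (fun q : {q : ZMod n × B // z q.1 ∈ cylImage R ρ q.2} =>
      (⟨(q.1.1 + 1, t q), htz q⟩ : {q : ZMod n × B // z q.1 ∈ cylImage R ρ q.2}))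
  have hidx : ∀ k : ℤ, (e k).1.1 = (e 0).1.1 + k := by
    have step : ∀ k : ℤ, (e (k + 1)).1.1 = (e k).1.1 + 1 := fun k => by rw [he]
    intro k
    induction k with
    | zero => simp
    | succ k ih => rw [step, ih]; push_cast; ring
    | pred k ih =>
      have := step (-(k : ℤ) - 1)
      rw [sub_add_cancel, ih] at this
      rw [← sub_eq_iff_eq_add] at this
      rw [← this]
      push_cast
      ring
  let y : ℤ → B := fun k => (e (k - (e 0).1.1.val)).1.2
  have hy : y ∈ biPaths R := fun i => by
    have := htR (e (i - (e 0).1.1.val))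
    simp only [y]
    rw [show i + 1 - ((e 0).1.1.val : ℤ) = i - (e 0).1.1.val + 1 by ring, he]
    exact this
  have hyz : ∀ k : ℤ, z k ∈ cylImage R ρ (y k) := fun k => by
    have := (e (k - (e 0).1.1.val)).2
    have hk : (e (k - (e 0).1.1.val)).1.1 = k := by
      rw [hidx]
      push_cast
      rw [ZMod.natCast_zmod_val]
      ring
    rwa [hk] at this
  have hyp : ∀ k : ℤ, (f.toEquiv ^ k) (ρ y) ∈ cylImage R ρ (y k) := fun k => by
    rw [← map_shift_zpow hequiv hy]
    refine ⟨_, ⟨fun i => ?_, by simp⟩, rfl⟩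
    have := hy (i + k)
    rwa [add_right_comm] at this
  have hdist : ∀ k : ℤ, dist ((f.toEquiv ^ k) (ρ y)) (z k) ≤ ε / 2 := fun k =>
    hdiam _ _ (hyp k) _ (hyz k)
  have hiter : ∀ (k : ℕ) (p : Ω), f^[k] p = (f.toEquiv ^ (k : ℤ)) p := fun k p => by
    rw [zpow_natCast, ← Equiv.Perm.iterate_eq_pow]
    rfl
  refine ⟨ρ y, ?_, fun k => by simpa [hiter] using hdist k⟩
  by_contra hp
  obtain ⟨k, hk⟩ := hexp _ _ hp
  rw [hiter, ← Equiv.Perm.mul_apply, ← zpow_add] at hk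
  have h1 := hdist (k + n)
  have h2 := hdist k
  push_cast at h1
  rw [ZMod.natCast_self, add_zero] at h1
  linarith [dist_triangle_right ((f.toEquiv ^ (k + n : ℤ)) (ρ y)) ((f.toEquiv ^ k) (ρ y)) (z k)]

theorem zpow_apply_eq_iterate_emod {Ω : Type*} (F : Equiv.Perm Ω) {c : ℕ} (hc : 0 < c) {x : Ω}
    (hx : F^[c] x = x) (t : ℤ) : (F ^ t) x = F^[(t % c).toNat] x := by
  have h0 := Int.emod_nonneg t (by exact_mod_cast hc.ne' : (c : ℤ) ≠ 0)
  have hx' : (F ^ (c : ℤ)) x = x := by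
    rw [zpow_natCast, ← Equiv.Perm.iterate_eq_pow, hx]
  rw [Equiv.Perm.iterate_eq_pow, ← zpow_natCast, Int.toNat_of_nonneg h0]
  conv_lhs => rw [← Int.emod_add_mul_ediv t c, zpow_add, Equiv.Perm.mul_apply, zpow_mul,
    Equiv.Perm.zpow_apply_eq_self_of_apply_eq_self hx']

/-- Two points with a common period whose orbits stay within the expansive constant over one period
coincide. -/
theorem eq_of_isPeriodicPt_of_dist_le {Ω : Type*} [MetricSpace Ω] {F : Equiv.Perm Ω} {ε : ℝ}
    (hexp : ∀ x y : Ω, x ≠ y → ∃ n : ℤ, ε < dist ((F ^ n) x) ((F ^ n) y))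
    {c : ℕ} (hc : 0 < c) {x y : Ω} (hx : F^[c] x = x) (hy : F^[c] y = y)
    (h : ∀ i < c, dist (F^[i] x) (F^[i] y) ≤ ε) : x = y := by
  by_contra hne
  obtain ⟨t, ht⟩ := hexp x y hne
  rw [zpow_apply_eq_iterate_emod F hc hx, zpow_apply_eq_iterate_emod F hc hy] at ht
  have h1 := Int.emod_lt_of_pos t (by exact_mod_cast hc : (0 : ℤ) < c)
  exact (h _ (by omega)).not_gt ht

theorem ZMod.val_add_one_of_val_lt {n : ℕ} {i : ZMod n} (h : i.val + 1 < n) :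
    (i + 1).val = i.val + 1 := by
  have : NeZero n := ⟨by omega⟩
  have h1 := ZMod.val_natCast_of_lt h
  rwa [Nat.cast_add_one, ZMod.natCast_zmod_val] at h1

/-- Two orbit segments from `U` to `U`, of lengths `a` and `m`, give a periodic orbit which follows
the first segment `k` times and then the second one, provided `U` has the periodic shadowing
property. -/
theorem exists_periodic_concat {Ω : Type*} [MetricSpace Ω] {f : Ω → Ω} {U : Set Ω} {δ : ℝ}
    (hU : ∀ n : ℕ, 0 < n → ∀ z : ZMod n → Ω,
      (∀ i, z (i + 1) = f (z i) ∨ f (z i) ∈ U ∧ z (i + 1) ∈ U) →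
      ∃ p, f^[n] p = p ∧ ∀ k : ℕ, dist (f^[k] p) (z k) ≤ δ)
    {a k m : ℕ} (ha : 0 < a) (hk : 0 < k) (hm : 0 < m) {q r : Ω}
    (hq : q ∈ U) (hq' : f^[a] q ∈ U) (hr : r ∈ U) (hr' : f^[m] r ∈ U) :
    ∃ p, f^[k * a + m] p = p ∧ (∀ i < k * a, dist (f^[i] p) (f^[i % a] q) ≤ δ) ∧
      ∀ i < m, dist (f^[k * a + i] p) (f^[i] r) ≤ δ := by
  have hka : 0 < k * a := Nat.mul_pos hk ha
  have hn : 0 < k * a + m := by omega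
  have : NeZero (k * a + m) := ⟨hn.ne'⟩
  let w : ℕ → Ω := fun i => if i < k * a then f^[i % a] q else f^[i - k * a] r
  obtain ⟨p, hp, hd⟩ := hU _ hn (fun i => w i.val) (fun i => by
    have hi := ZMod.val_lt i
    rcases Nat.lt_or_ge (i.val + 1) (k * a + m) with h | h
    · have hs : (i + 1).val = i.val + 1 := by
        rw [ZMod.val_add_one_of_val_lt h]
      rw [hs]
      generalize i.val = j at *
      by_cases hj : j < k * a
      · have hmod := Nat.mod_lt j ha
        by_cases hja : j % a + 1 = a
        · have h0 : (j + 1) % a = 0 := by rw [← Nat.mod_add_mod, hja, Nat.mod_self]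
          right
          simp only [w, if_pos hj]
          rw [← Function.iterate_succ_apply' f, Nat.succ_eq_add_one, hja]
          refine ⟨hq', ?_⟩
          split_ifs with h1
          · rw [h0]
            exact hq
          · rw [show j + 1 - k * a = 0 by omega]
            exact hr
        · have h0 : (j + 1) % a = j % a + 1 := by
            rw [← Nat.mod_add_mod]
            exact Nat.mod_eq_of_lt (by omega)
          have h1 : j + 1 < k * a := by
            refine lt_of_le_of_ne hj fun h1 => ?_
            rw [h1, Nat.mul_mod_left] at h0
            omega
          left
          simp only [w, if_pos hj, if_pos h1]
          rw [h0, Function.iterate_succ_apply']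
      · left
        simp only [w, if_neg hj, if_neg (show ¬ j + 1 < k * a by omega)]
        rw [show j + 1 - k * a = j - k * a + 1 by omega, Function.iterate_succ_apply']
    · have h1 : i.val + 1 = k * a + m := by omega
      have hs : i + 1 = 0 := by
        rw [← ZMod.natCast_zmod_val i, ← Nat.cast_add_one, h1, ZMod.natCast_self]
      rw [hs, ZMod.val_zero]
      right
      simp only [w, if_pos hka, if_neg (show ¬ i.val < k * a by omega)]
      rw [← Function.iterate_succ_apply' f, show (i.val - k * a).succ = m by omega]
      exact ⟨hr', by simpa using hq⟩)
  refine ⟨p, hp, fun i hi => ?_, fun i hi => ?_⟩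
  · have := hd i
    rw [ZMod.val_natCast_of_lt (by omega)] at this
    simpa [w, hi] using this
  · have := hd (k * a + i)
    rw [ZMod.val_natCast_of_lt (by omega)] at this
    simpa [w] using this

theorem exists_forall_least_period {Ω : Type*} [MetricSpace Ω] [CompactSpace Ω] [Nontrivial Ω]
    {f : Ω ≃ₜ Ω} (hFP : IsFPSystem f) (hmix : TopMixing (⇑f)) :
    ∃ n₀ : ℕ, ∀ n ≥ n₀, n ∈ leastPeriodSet (⇑f) := by
  obtain ⟨ε, hε, hexp⟩ := hFP.1
  obtain ⟨U, hU, hne, hsh⟩ := exists_open_periodic_shadowing hFP hε hexp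
  obtain ⟨N, hN⟩ := hmix U U hU hU hne hne
  set a := N + 1 with ha_def
  have ha : 0 < a := by omega
  obtain ⟨q, hq, hq'⟩ := hN a (by omega)
  obtain ⟨p₀, hp₀, hd₀⟩ := hsh a ha (fun i => f^[i.val] q) (fun i => by
    have : NeZero a := ⟨ha.ne'⟩
    have hi := ZMod.val_lt i
    rcases Nat.lt_or_ge (i.val + 1) a with h | h
    · left
      rw [ZMod.val_add_one_of_val_lt h, Function.iterate_succ_apply']
    · right
      have h1 : i.val + 1 = a := by omega
      have hs : i + 1 = 0 := by
        rw [← ZMod.natCast_zmod_val i, ← Nat.cast_add_one, h1, ZMod.natCast_self]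
      rw [hs, ZMod.val_zero, ← Function.iterate_succ_apply' f, Nat.succ_eq_add_one, h1]
      exact ⟨hq', hq⟩)
  obtain ⟨v, hv⟩ := exists_ne p₀
  obtain ⟨t, ht⟩ := hexp v p₀ hv
  rw [zpow_apply_eq_iterate_emod f.toEquiv ha (x := p₀) hp₀] at ht
  set b := (t % a).toNat
  have hballs : IsOpen {u | ε < dist u (f^[b] p₀)} :=
    isOpen_lt continuous_const (by fun_prop)
  obtain ⟨N₁, hN₁⟩ := hmix U _ hU hballs hne ⟨_, ht⟩
  set j := b + N₁ * a
  have hj : f^[j] p₀ = f^[b] p₀ := by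
    have : f^[N₁ * a] p₀ = p₀ := (Function.IsPeriodicPt.const_mul (show
      Function.IsPeriodicPt f a p₀ from hp₀) N₁)
    rw [Function.iterate_add_apply, this]
  obtain ⟨N₂, hN₂⟩ := hmix (U ∩ f^[j] ⁻¹' {u | ε < dist u (f^[b] p₀)}) U
    (hU.inter (hballs.preimage (f.continuous.iterate j))) hU
    (hN₁ j (by
      have := Nat.le_mul_of_pos_right N₁ ha
      omega)) hne
  set M := N₂ + j + 1
  refine ⟨2 * M + 4 * a, fun n hn => ⟨by omega, ?_⟩⟩
  obtain ⟨k, m, hm, hma, rfl⟩ : ∃ k m, M ≤ m ∧ m < M + a ∧ n = k * a + m := by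
    have h1 := Nat.mod_lt (n - M) ha
    have h2 := Nat.div_add_mod' (n - M) a
    exact ⟨(n - M) / a, (n - M) % a + M, by omega, by omega, by omega⟩
  obtain ⟨r, ⟨hr, hrj⟩, hr'⟩ := hN₂ m (by omega)
  have hk : 0 < k := by
    rcases Nat.eq_zero_or_pos k with rfl | h
    · omega
    · exact h
  obtain ⟨p, hp, hd1, hd2⟩ := exists_periodic_concat hsh ha hk (by omega) hq hq' hr hr'
  refine ⟨p, hp, fun d hd hdn hdp => ?_⟩
  set c := Function.minimalPeriod f p
  have hc : 0 < c := Function.IsPeriodicPt.minimalPeriod_pos hd hdp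
  have hcd : c ≤ d := Function.IsPeriodicPt.minimalPeriod_le hd hdp
  have hcp : f^[c] p = p := Function.iterate_minimalPeriod
  have hcn : 2 * c ≤ k * a + m := by
    obtain ⟨l, hl⟩ := Function.IsPeriodicPt.minimalPeriod_dvd (show
      Function.IsPeriodicPt f (k * a + m) p from hp)
    have hl2 : 2 ≤ l := by
      by_contra h
      have : l = 0 ∨ l = 1 := by omega
      rcases this with rfl | rfl
      · omega
      · omega
    rw [hl]
    nlinarith
  have hpa : f^[a] p = p := by
    refine (eq_of_isPeriodicPt_of_dist_le hexp hc (x := p) (y := f^[a] p) hcp ?_ ?_).symm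
    · change f^[c] (f^[a] p) = f^[a] p
      rw [← Function.iterate_add_apply, add_comm, Function.iterate_add_apply, hcp]
    · intro i hi
      change dist (f^[i] p) (f^[i] (f^[a] p)) ≤ ε
      rw [← Function.iterate_add_apply]
      have h1 := hd1 i (by omega)
      have h2 := hd1 (i + a) (by omega)
      rw [Nat.add_mod_right] at h2
      linarith [dist_triangle_right (f^[i] p) (f^[i + a] p) (f^[i % a] q)]
  have hpp : p = p₀ := by
    refine eq_of_isPeriodicPt_of_dist_le hexp ha (x := p) (y := p₀) hpa hp₀ ?_
    intro i hi
    change dist (f^[i] p) (f^[i] p₀) ≤ ε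
    have : NeZero a := ⟨ha.ne'⟩
    have h1 := hd1 i (by omega)
    have h2 := hd₀ i
    rw [Nat.mod_eq_of_lt hi] at h1
    rw [ZMod.val_natCast_of_lt hi] at h2
    linarith [dist_triangle_right (f^[i] p) (f^[i] p₀) (f^[i] q)]
  have h1 := hd2 j (by omega)
  have h2 : f^[k * a] p₀ = p₀ := (Function.IsPeriodicPt.const_mul (show
      Function.IsPeriodicPt f a p₀ from hp₀) k)
  rw [hpp, add_comm, Function.iterate_add_apply, h2, hj, dist_comm] at h1
  have h3 : ε < dist (f^[j] r) (f^[b] p₀) := hrj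
  linarith

/-- The least period set of a topologically mixing finitely presented system is either
`{1}` or a cofinite subset of `ℕ = {1, 2, ...}`. -/
theorem LPS_of_mixing_FP {Ω : Type*} [MetricSpace Ω] [CompactSpace Ω] [Nonempty Ω]
    (f : Ω ≃ₜ Ω) (hFP : IsFPSystem f) (hmix : TopMixing (⇑f)) :
    leastPeriodSet (⇑f) = {1} ∨ CofinitePos (leastPeriodSet (⇑f)) := by
  rcases subsingleton_or_nontrivial Ω with h | h
  · left
    ext n
    constructor
    · rintro ⟨hn, x, -, hx⟩
      by_contra hne
      exact hx 1 one_pos (lt_of_le_of_ne hn (Ne.symm hne)) (Subsingleton.elim _ _)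
    · rintro rfl
      exact ⟨one_pos, Classical.arbitrary Ω, Subsingleton.elim _ _, fun k h0 h1 => by omega⟩
  · right
    obtain ⟨n₀, hn₀⟩ := exists_forall_least_period hFP hmix
    refine ⟨fun n hn => hn.1, (Set.finite_lt_nat n₀).subset fun n hn => ?_⟩
    exact not_le.1 fun h => hn.2 (hn₀ n h)
end

section
/- Let X be a nonempty one-step shift of finite type over a finite alphabet. Then there exist a finite set F ⊆ ℕ, an integer n ≥ 0, positive integers d_1, ..., d_n, and cofinite sets S_1, ..., S_n ⊆ ℕ such that LPS(X) = F ∪ ⋃_{i=1}^n d_i S_i; moreover LPS(X) ≠ ∅, i.e., F and the union may not both be empty. -/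
/-- The least period set of the shift restricted to a subset `X` of the full shift. -/
def LPSset {A : Type*} (X : Set (ℤ → A)) : Set ℕ :=
  {n | 0 < n ∧ ∃ x ∈ X, shiftMap^[n] x = x ∧ ∀ k, 0 < k → k < n → shiftMap^[k] x ≠ x}

theorem shiftMap_iterate_apply {A : Type*} (n : ℕ) (x : ℤ → A) (i : ℤ) :
    shiftMap^[n] x i = x (i + n) := by
  induction n generalizing i with
  | zero => simp
  | succ n ih =>
    rw [Function.iterate_succ_apply']
    simp only [shiftMap, ih]
    congr 1
    push_cast
    ring

theorem shiftMap_iterate_eq_iff {A : Type*} (n : ℕ) (x : ℤ → A) :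
    shiftMap^[n] x = x ↔ Function.Periodic x (n : ℤ) := by
  simp only [funext_iff, shiftMap_iterate_apply, Function.Periodic]

namespace OneStepSFT

variable {A : Type*}

/-- The `n`-periodic points of the one-step SFT given by `R` with symbol `a` at the origin. -/
def loops (R : Set (A × A)) (a : A) (n : ℕ) : Set (ℤ → A) :=
  {x | (∀ i : ℤ, (x i, x (i + 1)) ∈ R) ∧ x 0 = a ∧ Function.Periodic x (n : ℤ)}

/-- The least periods of points of the one-step SFT given by `R` with symbol `a` at the origin. -/
def leastPeriods (R : Set (A × A)) (a : A) : Set ℕ :=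
  {n | 0 < n ∧ ∃ x ∈ loops R a n, ∀ k : ℕ, 0 < k → k < n → ¬ Function.Periodic x (k : ℤ)}

/-- The lengths of loops based at `a`. -/
def loopLengths (R : Set (A × A)) (a : A) : Set ℕ :=
  {n | 0 < n ∧ (loops R a n).Nonempty}

/-- The `(m + n)`-periodic sequence repeating `x 0, …, x (m - 1), y 0, …, y (n - 1)`. -/
def concat (m n : ℕ) (x y : ℤ → A) : ℤ → A := fun i =>
  if i % ((m : ℤ) + n) < m then x (i % ((m : ℤ) + n)) else y (i % ((m : ℤ) + n) - m)

theorem concat_periodic (m n : ℕ) (x y : ℤ → A) :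
    Function.Periodic (concat m n x y) ((m + n : ℕ) : ℤ) := by
  intro i
  simp [concat]

theorem concat_of_lt {m n : ℕ} (x y : ℤ → A) {i : ℤ} (h0 : 0 ≤ i) (h : i < m) :
    concat m n x y i = x i := by
  have : i % ((m : ℤ) + n) = i := Int.emod_eq_of_lt h0 (by omega)
  simp [concat, this, h]

theorem concat_add {m n : ℕ} (x y : ℤ → A) {i : ℤ} (h0 : 0 ≤ i) (h : i < n) :
    concat m n x y (m + i) = y i := by
  have : (m + i) % ((m : ℤ) + n) = m + i := Int.emod_eq_of_lt (by omega) (by omega)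
  simp [concat, this, h0]

theorem concat_mem_loops {R : Set (A × A)} {a : A} {m n : ℕ} (hm : 0 < m) (hn : 0 < n)
    {x y : ℤ → A} (hx : x ∈ loops R a m) (hy : y ∈ loops R a n) :
    concat m n x y ∈ loops R a (m + n) := by
  obtain ⟨hxR, hx0, hxp⟩ := hx
  obtain ⟨hyR, hy0, hyp⟩ := hy
  have hz0 : concat m n x y 0 = a := by
    rw [concat_of_lt x y le_rfl (by exact_mod_cast hm), hx0]
  have hp := concat_periodic m n x y
  refine ⟨fun i => ?_, hz0, hp⟩
  have hM : (0 : ℤ) < ((m + n : ℕ) : ℤ) := by positivity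
  have hred : ∀ j, concat m n x y (i % ((m + n : ℕ) : ℤ) + j) = concat m n x y (i + j) := by
    intro j
    have h := hp.sub_zsmul_eq (x := i + j) (i / ((m + n : ℕ) : ℤ))
    rw [← h]
    congr 1
    rw [Int.emod_def, smul_eq_mul]
    ring
  have h1 := hred 0
  rw [add_zero, add_zero] at h1
  rw [← h1, ← hred 1]
  have hr0 := Int.emod_nonneg i hM.ne'
  have hrM := Int.emod_lt_of_pos i hM
  generalize i % ((m + n : ℕ) : ℤ) = r at hr0 hrM
  push_cast at hrM
  rcases lt_trichotomy (r + 1) (m : ℤ) with h | h | h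
  · rw [concat_of_lt x y hr0 (by omega), concat_of_lt x y (by omega) h]
    exact hxR r
  · have e : concat m n x y (r + 1) = x (r + 1) := by
      have h2 := concat_add (m := m) x y le_rfl (show (0 : ℤ) < n by omega)
      have h3 := hxp 0
      rw [add_zero] at h2
      rw [zero_add] at h3
      rw [h, h2, h3, hx0, hy0]
    rw [e, concat_of_lt x y hr0 (by omega)]
    exact hxR r
  · obtain ⟨s, rfl⟩ : ∃ s, r = m + s := ⟨r - m, by ring⟩
    rw [concat_add x y (by omega) (by omega)]
    have e : concat m n x y (m + s + 1) = y (s + 1) := by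
      by_cases hs : s + 1 < n
      · rw [add_assoc, concat_add x y (by omega) hs]
      · have hs' : s + 1 = n := by omega
        have h2 := hp 0
        have h3 := hyp 0
        rw [zero_add] at h2 h3
        rw [add_assoc, hs', h3, hy0, ← hz0, ← h2]
        push_cast
        rfl
    rw [e]
    exact hyR s

theorem loops_mul {R : Set (A × A)} {a : A} {n : ℕ} {x : ℤ → A} (hx : x ∈ loops R a n) (k : ℕ) :
    x ∈ loops R a (k * n) := by
  refine ⟨hx.1, hx.2.1, ?_⟩
  have := hx.2.2.nat_mul k
  exact_mod_cast this

theorem leastPeriods_subset_loopLengths (R : Set (A × A)) (a : A) :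
    leastPeriods R a ⊆ loopLengths R a :=
  fun _ ⟨hn, x, hx, _⟩ => ⟨hn, x, hx⟩

theorem exists_mem_loopLengths (R : Set (A × A)) (a : A) :
    ∃ c : ℕ, ∀ m, c ≤ m → Nat.setGcd (loopLengths R a) ∣ m → m ∈ loopLengths R a := by
  obtain ⟨c, hc⟩ := Nat.exists_mem_closure_of_ge (loopLengths R a)
  refine ⟨c + 1, fun m hm hd => ?_⟩
  have key : ∀ k ∈ AddSubmonoid.closure (loopLengths R a), k = 0 ∨ k ∈ loopLengths R a := by
    intro k hk
    induction hk using AddSubmonoid.closure_induction with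
    | mem k hk => exact Or.inr hk
    | zero => exact Or.inl rfl
    | add k l _ _ hk hl =>
      rcases hk with rfl | ⟨hk, x, hx⟩
      · simpa using hl
      rcases hl with rfl | ⟨hl, y, hy⟩
      · exact Or.inr ⟨hk, x, hx⟩
      · exact Or.inr ⟨by omega, _, concat_mem_loops hk hl hx hy⟩
  exact (key m (hc m (by omega) hd)).resolve_left (by omega)

/-- If loops at `a` are determined by their length, there is at most one least period at `a`. -/
theorem leastPeriods_subsingleton {R : Set (A × A)} {a : A}
    (h : ∀ l, 0 < l → (loops R a l).Subsingleton) : (leastPeriods R a).Subsingleton := by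
  rintro n ⟨hn, x, hx, hx'⟩ m ⟨hm, y, hy, hy'⟩
  have hxy : x = y := h (n * m) (by positivity) (mul_comm m n ▸ loops_mul hx m) (loops_mul hy n)
  subst hxy
  rcases lt_trichotomy n m with hlt | heq | hlt
  · exact absurd hx.2.2 (hy' n hn hlt)
  · exact heq
  · exact absurd hy.2.2 (hx' m hm hlt)

/-- A sequence of period `N` that starts with more than half a period of an `l`-periodic sequence
and has a proper smaller period is itself `l`-periodic. -/
theorem periodic_of_agree {z x : ℤ → A} {N k l t : ℕ} (hz : Function.Periodic z (N : ℤ))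
    (hx : Function.Periodic x (l : ℤ)) (hk : 0 < k) (hkN : k < N)
    (hzk : Function.Periodic z (k : ℤ)) (ht : N + 2 * l ≤ 2 * t)
    (hzx : ∀ i : ℤ, 0 ≤ i → i < t → z i = x i) : Function.Periodic z (l : ℤ) := by
  obtain ⟨e, he⟩ : ∃ e, e = k.gcd N := ⟨_, rfl⟩
  have hze : Function.Periodic z (e : ℤ) := by
    rw [← shiftMap_iterate_eq_iff] at hz hzk ⊢
    rw [he]
    exact Function.IsPeriodicPt.gcd hzk hz
  have he0 : 0 < e := he ▸ Nat.gcd_pos_of_pos_left N hk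
  have hek : e ≤ k := he ▸ Nat.gcd_le_left N hk
  have heN : 2 * e ≤ N := by
    obtain ⟨c, hc⟩ : e ∣ N := he ▸ Nat.gcd_dvd_right k N
    have : 2 ≤ c := by
      by_contra hlt
      interval_cases c <;> omega
    nlinarith
  intro i
  have hred : ∀ j, z (i + j) = z (i % (e : ℤ) + j) := by
    intro j
    rw [← hze.sub_zsmul_eq (x := i + j) (i / (e : ℤ)), Int.emod_def, smul_eq_mul]
    congr 1
    ring
  have h0 := hred 0
  rw [add_zero, add_zero] at h0
  have hr0 := Int.emod_nonneg i (show (e : ℤ) ≠ 0 by omega)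
  have hre := Int.emod_lt_of_pos i (show (0 : ℤ) < e by omega)
  rw [hred, h0, hzx _ (by omega) (by omega), hzx _ (by omega) (by omega), hx]

/-- If there are two different loops at `a` of the same length, then all large multiples of the
greatest common divisor of the loop lengths are least periods. -/
theorem exists_mem_leastPeriods {R : Set (A × A)} {a : A} {l : ℕ} (hl : 0 < l) {x y : ℤ → A}
    (hx : x ∈ loops R a l) (hy : y ∈ loops R a l) (hxy : x ≠ y) :
    ∃ c : ℕ, ∀ N, c ≤ N → Nat.setGcd (loopLengths R a) ∣ N → N ∈ leastPeriods R a := by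
  obtain ⟨c, hc⟩ := exists_mem_loopLengths R a
  refine ⟨2 * c + 6 * l, fun N hN hd => ?_⟩
  obtain ⟨k, hk⟩ : ∃ k, k + 1 = (N - c) / l :=
    ⟨(N - c) / l - 1, Nat.sub_add_cancel ((Nat.one_le_div_iff hl).2 (by omega))⟩
  have hk1 : (k + 1) * l ≤ N - c := hk ▸ Nat.div_mul_le_self _ _
  have hk2 : N - c < (k + 1) * l + l := by
    have := Nat.lt_div_mul_add (a := N - c) hl
    rwa [← hk] at this
  have hkl : (k + 1) * l = k * l + l := by ring
  have hdl : Nat.setGcd (loopLengths R a) ∣ l := Nat.setGcd_dvd_of_mem ⟨hl, x, hx⟩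
  obtain ⟨hw0, w, hw⟩ := hc (N - (k + 1) * l) (by omega)
    (Nat.dvd_sub hd (hdl.mul_left _))
  generalize hn : N - (k + 1) * l = n at *
  have hv := concat_mem_loops hl hw0 hy hw
  have hz := concat_mem_loops (m := k * l) (by omega) (by omega) (loops_mul hx k) hv
  have hNe : k * l + (l + n) = N := by omega
  generalize hzdef : concat (k * l) (l + n) x (concat l n y w) = z at hz
  rw [hNe] at hz
  have hzx : ∀ i : ℤ, 0 ≤ i → i < (k * l : ℕ) → z i = x i := by
    intro i h0 h1
    rw [← hzdef, concat_of_lt _ _ h0 h1]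
  refine ⟨by omega, z, hz, fun j hj hjN hzj => hxy ?_⟩
  have hzl := periodic_of_agree hz.2.2 hx.2.2 hj hjN hzj (by omega) hzx
  have hloc : ∀ i : ℤ, 0 ≤ i → i < l → x i = y i := by
    intro i h0 h1
    rw [← hzx i h0 (by omega), ← concat_of_lt (n := n) y w h0 h1,
      ← concat_add (m := k * l) (n := l + n) x (concat l n y w) h0 (by omega), hzdef]
    have := hzl.nat_mul k i
    rw [← this, add_comm]
    push_cast
    rfl
  funext i
  have hr0 := Int.emod_nonneg i (show (l : ℤ) ≠ 0 by omega)
  have hrl := Int.emod_lt_of_pos i (show (0 : ℤ) < l by omega)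
  have := hloc _ hr0 hrl
  rw [Int.emod_def, mul_comm, ← smul_eq_mul, hx.2.2.sub_zsmul_eq, hy.2.2.sub_zsmul_eq] at this
  exact this

theorem leastPeriods_eq_image {R : Set (A × A)} {a : A}
    (h : ¬ ∀ l, 0 < l → (loops R a l).Subsingleton) :
    ∃ (d : ℕ) (S : Set ℕ), 0 < d ∧ CofinitePos S ∧ leastPeriods R a = (fun s => d * s) '' S := by
  simp only [not_forall, Set.not_subsingleton_iff] at h
  obtain ⟨l, hl, x, hx, y, hy, hxy⟩ := h
  obtain ⟨c, hc⟩ := exists_mem_leastPeriods hl hx hy hxy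
  have hdvd : ∀ n ∈ loopLengths R a, Nat.setGcd (loopLengths R a) ∣ n :=
    fun n hn => Nat.setGcd_dvd_of_mem hn
  have hd : 0 < Nat.setGcd (loopLengths R a) := Nat.pos_of_dvd_of_pos (hdvd l ⟨hl, x, hx⟩) hl
  generalize Nat.setGcd (loopLengths R a) = d at *
  refine ⟨d, {s | d * s ∈ leastPeriods R a}, hd, ⟨?_, ?_⟩, ?_⟩
  · intro s hs
    exact Nat.pos_of_mul_pos_left hs.1
  · refine (Set.finite_lt_nat c).subset ?_
    rintro s ⟨-, hs⟩
    by_contra hcs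
    simp only [Set.mem_ofPred_eq, not_lt] at hcs
    exact hs (hc _ (hcs.trans (Nat.le_mul_of_pos_left s hd)) (dvd_mul_right d s))
  · ext n
    constructor
    · intro hn
      obtain ⟨s, rfl⟩ := hdvd n (leastPeriods_subset_loopLengths R a hn)
      exact ⟨s, hn, rfl⟩
    · rintro ⟨s, hs, rfl⟩
      exact hs

theorem LPSset_eq_iUnion (R : Set (A × A)) :
    LPSset {x : ℤ → A | ∀ i : ℤ, (x i, x (i + 1)) ∈ R} = ⋃ a, leastPeriods R a := by
  ext n
  simp only [LPSset, shiftMap_iterate_eq_iff, Set.mem_iUnion, ne_eq, Set.mem_ofPred_eq,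
    leastPeriods, loops]
  constructor
  · rintro ⟨hn, x, hx, hp, hmin⟩
    exact ⟨x 0, hn, x, ⟨hx, rfl, hp⟩, hmin⟩
  · rintro ⟨a, hn, x, ⟨hx, -, hp⟩, hmin⟩
    exact ⟨hn, x, hx, hp, hmin⟩

theorem exists_periodic [Finite A] {R : Set (A × A)} {x : ℤ → A}
    (hx : ∀ i : ℤ, (x i, x (i + 1)) ∈ R) :
    ∃ n : ℕ, 0 < n ∧ ∃ y : ℤ → A, (∀ i : ℤ, (y i, y (i + 1)) ∈ R) ∧
      Function.Periodic y (n : ℤ) := by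
  obtain ⟨i, j, hij, he⟩ : ∃ i j : ℕ, i < j ∧ x i = x j := by
    obtain ⟨i, j, hne, he⟩ := Finite.exists_ne_map_eq_of_infinite (fun k : ℕ => x k)
    rcases lt_or_gt_of_ne hne with h | h
    · exact ⟨i, j, h, he⟩
    · exact ⟨j, i, h, he.symm⟩
  obtain ⟨n, rfl⟩ := Nat.exists_eq_add_of_lt hij
  refine ⟨n + 1, by omega, fun k => x (i + k % ((n : ℤ) + 1)), fun k => ?_, fun k => ?_⟩
  · have hr0 := Int.emod_nonneg k (show (n : ℤ) + 1 ≠ 0 by omega)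
    have hrl := Int.emod_lt_of_pos k (show (0 : ℤ) < (n : ℤ) + 1 by omega)
    have e : x (i + (k + 1) % ((n : ℤ) + 1)) = x (i + k % ((n : ℤ) + 1) + 1) := by
      rw [← Int.emod_add_emod]
      generalize k % ((n : ℤ) + 1) = r at *
      by_cases h : r + 1 < (n : ℤ) + 1
      · rw [Int.emod_eq_of_lt (by omega) h, add_assoc]
      · have hr : r + 1 = (n : ℤ) + 1 := by omega
        rw [add_assoc, hr, Int.emod_self, add_zero, he]
        push_cast
        rw [add_assoc]
    simp only [e]
    exact hx _
  · simp

theorem LPSset_ne_empty [Finite A] {R : Set (A × A)} {x : ℤ → A}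
    (hx : ∀ i : ℤ, (x i, x (i + 1)) ∈ R) :
    LPSset {x : ℤ → A | ∀ i : ℤ, (x i, x (i + 1)) ∈ R} ≠ ∅ := by
  classical
  obtain ⟨n, hn, y, hy, hyp⟩ := exists_periodic hx
  have hex : ∃ n : ℕ, 0 < n ∧ shiftMap^[n] y = y := ⟨n, hn, (shiftMap_iterate_eq_iff n y).2 hyp⟩
  refine Set.Nonempty.ne_empty ⟨Nat.find hex, (Nat.find_spec hex).1, y, hy,
    (Nat.find_spec hex).2, fun k hk hlt h => Nat.find_min hex hlt ⟨hk, h⟩⟩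

end OneStepSFT

/-- The least period set of a nonempty one-step SFT is a union of a finite set and
finitely many sets `dᵢ Sᵢ` with `Sᵢ` cofinite, and it is nonempty. -/
theorem LPS_of_SFT {A : Type*} [Fintype A] [TopologicalSpace A] [DiscreteTopology A]
    (X : Set (ℤ → A)) (hSFT : IsOneStepSFT X) (hne : X.Nonempty) :
    ∃ (F : Finset ℕ) (n : ℕ) (d : Fin n → ℕ) (S : Fin n → Set ℕ),
      (∀ m ∈ F, 0 < m) ∧ (∀ i, 0 < d i) ∧ (∀ i, CofinitePos (S i)) ∧
      LPSset X = ↑F ∪ ⋃ i : Fin n, (fun s => d i * s) '' S i ∧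
      LPSset X ≠ ∅ := by
  classical
  obtain ⟨R, rfl⟩ := hSFT
  obtain ⟨x, hx⟩ := hne
  let P : A → Prop := fun a => ∀ l, 0 < l → (OneStepSFT.loops R a l).Subsingleton
  have hfin : (⋃ a : {a // P a}, OneStepSFT.leastPeriods R a.1).Finite :=
    Set.finite_iUnion fun a => (OneStepSFT.leastPeriods_subsingleton a.2).finite
  choose d S hd hS hdS using
    fun a : {a // ¬ P a} => OneStepSFT.leastPeriods_eq_image (R := R) (a := a.1) a.2
  let e := Fintype.equivFin {a // ¬ P a}
  refine ⟨hfin.toFinset, Fintype.card {a // ¬ P a}, fun i => d (e.symm i), fun i => S (e.symm i),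
    ?_, fun i => hd _, fun i => hS _, ?_, OneStepSFT.LPSset_ne_empty hx⟩
  · intro m hm
    rw [Set.Finite.mem_toFinset, Set.mem_iUnion] at hm
    obtain ⟨a, ha⟩ := hm
    exact ha.1
  · rw [OneStepSFT.LPSset_eq_iUnion, Set.Finite.coe_toFinset]
    simp only [← hdS]
    rw [e.symm.surjective.iUnion_comp (fun a => OneStepSFT.leastPeriods R a.1)]
    ext n
    simp only [Set.mem_union, Set.mem_iUnion, Subtype.exists, exists_prop]
    constructor
    · rintro ⟨a, ha⟩
      by_cases hP : P a
      · exact Or.inl ⟨a, hP, ha⟩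
      · exact Or.inr ⟨a, hP, ha⟩
    · rintro (⟨a, -, ha⟩ | ⟨a, -, ha⟩) <;> exact ⟨a, ha⟩
end
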